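/- arXiv:2407.20373 — 2 statements merged into one kernel-verified Lean document; each statement's English description precedes it below -/
import Mathlib

section
/- Let p ∈ (1,∞), N ≥ 2, let m be a positive integer, let Ω ⊂ ℝ^N be an open bounded convex set and let φ be a positive (1/m)-concave weight on Ω. If ū is a first eigenfunction associated with the Neumann eigenvalue μ_p(Ω,φ), then ‖ū‖_{L^∞(Ω)} ≤ K_∞(N+m)·μ_p(Ω,φ)^{(N+m)/p}·D_Ω^{N+m}·(∫_Ω φ)^{−1/p}·‖ū‖_{L^p(Ω,φ)}, where K_∞(k) := 2^{2k}·ω_k^{−1}·(1+4k^{k+1})^k·(k/(k−1))^{k(k−1)} and ω_k is the Lebesgue measure of the unit ball of ℝ^k. -/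
open MeasureTheory Set Filter Topology

/-- `π_p := 2π (p-1)^{1/p} / (p sin(π/p))`. -/
noncomputable def piP (p : ℝ) : ℝ :=
  2 * Real.pi * (p - 1) ^ (1 / p) / (p * Real.sin (Real.pi / p))

/-- The first nontrivial Neumann `p`-Laplacian eigenvalue of `Ω` with weight `φ`. -/
noncomputable def muP (p : ℝ) {N : ℕ} (Ω : Set (EuclideanSpace ℝ (Fin N)))
    (φ : EuclideanSpace ℝ (Fin N) → ℝ) : ℝ :=
  sInf { r : ℝ | ∃ (u : EuclideanSpace ℝ (Fin N) → ℝ) (K : NNReal),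
    LipschitzWith K u ∧
    ¬ (∀ᵐ x ∂(volume.restrict Ω), u x = 0) ∧
    (∫ x in Ω, φ x * |u x| ^ (p - 2) * u x) = 0 ∧
    r = (∫ x in Ω, φ x * ‖fderiv ℝ u x‖ ^ p) / (∫ x in Ω, φ x * |u x| ^ p) }

/-- A first eigenfunction for `μ_p(Ω,φ)`: a locally Lipschitz (on `Ω`) function, not a.e.
zero, with `∫_Ω φ |u|^{p-2} u = 0`, finite weighted energy and `p`-norm, realizing the
infimum: `∫_Ω φ |∇u|^p = μ_p(Ω,φ) ∫_Ω φ |u|^p`. -/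
def IsFirstEigenfunction (p : ℝ) {N : ℕ} (Ω : Set (EuclideanSpace ℝ (Fin N)))
    (φ : EuclideanSpace ℝ (Fin N) → ℝ) (u : EuclideanSpace ℝ (Fin N) → ℝ) : Prop :=
  (∀ x ∈ Ω, ∃ (K : NNReal) (t : Set (EuclideanSpace ℝ (Fin N))),
      t ∈ nhdsWithin x Ω ∧ LipschitzOnWith K u t) ∧
  ¬ (∀ᵐ x ∂(volume.restrict Ω), u x = 0) ∧
  IntegrableOn (fun x => φ x * |u x| ^ p) Ω volume ∧
  IntegrableOn (fun x => φ x * ‖fderiv ℝ u x‖ ^ p) Ω volume ∧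
  (∫ x in Ω, φ x * |u x| ^ (p - 2) * u x) = 0 ∧
  (∫ x in Ω, φ x * ‖fderiv ℝ u x‖ ^ p) = muP p Ω φ * ∫ x in Ω, φ x * |u x| ^ p

/-- The constant `K_∞(k) = 2^{2k} ω_k^{-1} (1+4k^{k+1})^k (k/(k-1))^{k(k-1)}`, where `ω_k`
is the volume of the unit ball of `ℝ^k`. -/
noncomputable def Kinf (k : ℕ) : ℝ :=
  2 ^ (2 * k) * ((volume (Metric.ball (0 : EuclideanSpace ℝ (Fin k)) 1)).toReal)⁻¹ *
    (1 + 4 * (k : ℝ) ^ (k + 1)) ^ k * ((k : ℝ) / ((k : ℝ) - 1)) ^ (k * (k - 1))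

/-- A positive function is `α`-concave on `Ω` if its `α`-th power is concave. -/
def IsAlphaConcaveOn {N : ℕ} (α : ℝ) (Ω : Set (EuclideanSpace ℝ (Fin N)))
    (φ : EuclideanSpace ℝ (Fin N) → ℝ) : Prop :=
  (∀ x ∈ Ω, 0 < φ x) ∧ ConcaveOn ℝ Ω fun x => φ x ^ α

open scoped ENNReal NNReal

theorem lintegral_inv_sq_one_sub_le {δ : ℝ} (hδ : 0 < δ) (hδ1 : δ ≤ 1) :
    ∫⁻ t in Ioc (0 : ℝ) (1 - δ), ENNReal.ofReal ((1 - t) ^ 2)⁻¹ ≤ ENNReal.ofReal δ⁻¹ := by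
  have hne : ∀ t ∈ uIcc (0 : ℝ) (1 - δ), 1 - t ≠ 0 := by
    intro t ht
    rw [uIcc_of_le (by linarith)] at ht
    linarith [ht.2]
  have hcont : ContinuousOn (fun t : ℝ => ((1 - t) ^ 2)⁻¹) (uIcc (0 : ℝ) (1 - δ)) :=
    ContinuousOn.inv₀ (by fun_prop) fun t ht => pow_ne_zero _ (hne t ht)
  have hintegr := hcont.intervalIntegrable (μ := volume)
  have hval : ∫ t in (0 : ℝ)..(1 - δ), ((1 - t) ^ 2)⁻¹ = δ⁻¹ - 1 := by
    rw [intervalIntegral.integral_eq_sub_of_hasDerivAt (f := fun t : ℝ => (1 - t)⁻¹) _ hintegr]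
    · simp
    · intro t ht
      have := ((hasDerivAt_id t).const_sub 1).inv (hne t ht)
      convert! this using 1
      simp
  rw [← ofReal_integral_eq_lintegral_ofReal]
  · rw [← intervalIntegral.integral_of_le (by linarith), hval]
    exact ENNReal.ofReal_le_ofReal (by linarith)
  · exact (intervalIntegrable_iff_integrableOn_Ioc_of_le (by linarith)).1 hintegr
  · exact Eventually.of_forall fun t => by positivity

section DilationBound

variable {E : Type*} [NormedAddCommGroup E] [NormedSpace ℝ E]

/-- `g` is an upper gradient of `v` along the segments of `Ω`. -/
def IsUpperGradientOn (Ω : Set E) (v : E → ℝ) (g : E → ℝ≥0∞) : Prop :=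
  ∀ x ∈ Ω, ∀ y ∈ Ω, ENNReal.ofReal |v y - v x| ≤
    ENNReal.ofReal (dist x y) * ∫⁻ t in Ioo (0 : ℝ) 1, g ((1 - t) • x + t • y)

theorem LocallyLipschitzOn.isUpperGradientOn {Ω : Set E} (hconv : Convex ℝ Ω) {v : E → ℝ}
    (hv : LocallyLipschitzOn Ω v) {g : E → ℝ≥0∞}
    (hg : ∀ z ∈ Ω, g z = ∞ ∨ (DifferentiableAt ℝ v z ∧ ‖fderiv ℝ v z‖ₑ ≤ g z)) :
    IsUpperGradientOn Ω v g := by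
  intro x hx y hy
  rcases eq_or_ne x y with rfl | hxy
  · simp
  have hpos : 0 < dist x y := dist_pos.2 hxy
  set γ : ℝ → E := fun t => (1 - t) • x + t • y with hγ
  have hγΩ : ∀ t ∈ Icc (0 : ℝ) 1, γ t ∈ Ω := fun t ht =>
    hconv hx hy (by linarith [ht.2]) ht.1 (by ring)
  have hγd : ∀ t, HasDerivAt γ (y - x) t := by
    intro t
    have h1 : HasDerivAt (fun t : ℝ => (1 - t) • x) ((-1 : ℝ) • x) t :=
      ((hasDerivAt_id t).const_sub 1).smul_const x
    have h2 : HasDerivAt (fun t : ℝ => t • y) ((1 : ℝ) • y) t :=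
      (hasDerivAt_id t).smul_const y
    have := h1.add h2
    convert! this using 1
    simp [sub_eq_neg_add]
  have hγc : Continuous γ := by fun_prop
  obtain ⟨K, hK⟩ := (hv.mono (s := γ '' Icc (0 : ℝ) 1)
    (by rintro _ ⟨t, ht, rfl⟩; exact hγΩ t ht)).exists_lipschitzOnWith_of_compact
      (isCompact_Icc.image hγc)
  have hγl : LipschitzWith ‖y - x‖₊ γ := by
    refine lipschitzWith_of_nnnorm_deriv_le (fun t => (hγd t).differentiableAt) fun t => ?_
    rw [(hγd t).deriv]
  have hfl : LipschitzOnWith (K * ‖y - x‖₊) (v ∘ γ) (uIcc 0 1) := by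
    rw [uIcc_of_le zero_le_one]
    exact hK.comp hγl.lipschitzOnWith (mapsTo_image _ _)
  have hftc := hfl.absolutelyContinuousOnInterval.integral_deriv_eq_sub
  have hends : (v ∘ γ) 1 - (v ∘ γ) 0 = v y - v x := by simp [hγ]
  rw [hends, intervalIntegral.integral_of_le zero_le_one,
    integral_Ioc_eq_integral_Ioo] at hftc
  rw [← hftc, ← Real.enorm_eq_ofReal_abs, ← lintegral_const_mul' _ _ ENNReal.ofReal_ne_top]
  refine (enorm_integral_le_lintegral_enorm _).trans ?_
  refine setLIntegral_mono' measurableSet_Ioo fun t ht => ?_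
  rcases hg (γ t) (hγΩ t (Ioo_subset_Icc_self ht)) with h | ⟨hd, hle⟩
  · have : g ((1 - t) • x + t • y) = ∞ := h
    rw [this, ENNReal.mul_top (by simpa using hxy)]
    exact le_top
  · have hder : deriv (v ∘ γ) t = fderiv ℝ v (γ t) (y - x) :=
      (hd.hasFDerivAt.comp_hasDerivAt t (hγd t)).deriv
    rw [hder]
    refine (ContinuousLinearMap.le_opENorm _ _).trans ?_
    rw [mul_comm, dist_comm, dist_eq_norm, ofReal_norm]
    gcongr

variable [MeasurableSpace E] {k : ℕ} {Ω : Set E} {ν : Measure E}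

/-- Contracting `Ω` towards any of its points by a factor `t` multiplies `ν`-integrals by at most
`t ^ (-k)`. -/
def HasDilationBound (k : ℕ) (Ω : Set E) (ν : Measure E) : Prop :=
  ∀ x ∈ Ω, ∀ t : ℝ, 0 < t → t ≤ 1 → ∀ h : E → ℝ≥0∞, Measurable h →
    ∫⁻ y, h ((1 - t) • x + t • y) ∂ν ≤ ENNReal.ofReal (t ^ k)⁻¹ * ∫⁻ y, h y ∂ν

theorem HasDilationBound.setLIntegral_setLIntegral_le_left (h : HasDilationBound k Ω ν)
    (hΩ : ∀ᵐ x ∂ν, x ∈ Ω) (A B : Set E) {t : ℝ} (ht0 : 0 < t) (ht1 : t ≤ 1)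
    {f : E → ℝ≥0∞} (hf : Measurable f) :
    ∫⁻ x in A, ∫⁻ y in B, f ((1 - t) • x + t • y) ∂ν ∂ν ≤
      ν A * (ENNReal.ofReal (t ^ k)⁻¹ * ∫⁻ y, f y ∂ν) := by
  calc _ ≤ ∫⁻ _ in A, ENNReal.ofReal (t ^ k)⁻¹ * ∫⁻ y, f y ∂ν ∂ν := by
        refine lintegral_mono_ae ?_
        filter_upwards [ae_restrict_of_ae hΩ] with x hx
        exact (setLIntegral_le_lintegral _ _).trans (h x hx t ht0 ht1 f hf)
    _ = _ := by rw [setLIntegral_const, mul_comm]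

variable [BorelSpace E] [SecondCountableTopology E]

theorem HasDilationBound.setLIntegral_setLIntegral_le_right [SFinite ν]
    (h : HasDilationBound k Ω ν)
    (hΩ : ∀ᵐ x ∂ν, x ∈ Ω) (A B : Set E) {t : ℝ} (ht0 : 0 ≤ t) (ht1 : t < 1)
    {f : E → ℝ≥0∞} (hf : Measurable f) :
    ∫⁻ x in A, ∫⁻ y in B, f ((1 - t) • x + t • y) ∂ν ∂ν ≤
      ν B * (ENNReal.ofReal ((1 - t) ^ k)⁻¹ * ∫⁻ y, f y ∂ν) := by
  rw [lintegral_lintegral_swap (by fun_prop)]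
  have := h.setLIntegral_setLIntegral_le_left hΩ B A (t := 1 - t) (by linarith) (by linarith) hf
  simpa only [sub_sub_cancel, add_comm] using this

theorem lintegral_segment_swap [SFinite ν] (A B : Set E) (T : Set ℝ)
    {f : E → ℝ≥0∞} (hf : Measurable f) :
    ∫⁻ x in A, ∫⁻ y in B, (∫⁻ t in T, f ((1 - t) • x + t • y)) ∂ν ∂ν =
      ∫⁻ t in T, ∫⁻ x in A, ∫⁻ y in B, f ((1 - t) • x + t • y) ∂ν ∂ν := by
  have hm : Measurable fun q : E × E × ℝ => f ((1 - q.2.2) • q.1 + q.2.2 • q.2.1) := by fun_prop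
  have h1 : ∀ x, ∫⁻ y in B, (∫⁻ t in T, f ((1 - t) • x + t • y)) ∂ν =
      ∫⁻ t in T, ∫⁻ y in B, f ((1 - t) • x + t • y) ∂ν := fun x =>
    lintegral_lintegral_swap (by fun_prop)
  simp_rw [h1]
  refine lintegral_lintegral_swap (Measurable.aemeasurable ?_)
  have hm' : Measurable fun q : (E × ℝ) × E => f ((1 - q.1.2) • q.1.1 + q.1.2 • q.2) := by fun_prop
  exact hm'.lintegral_prod_right'

/-- A function with an upper gradient `g` that vanishes outside a small set `S` has small
integral: a Faber-Krahn type inequality in `L¹`. -/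
theorem HasDilationBound.lintegral_le_of_isUpperGradientOn [IsProbabilityMeasure ν] (hk : 2 ≤ k)
    (h : HasDilationBound k Ω ν) (hΩ : ∀ᵐ x ∂ν, x ∈ Ω) {D : ℝ}
    (hD : ∀ x ∈ Ω, ∀ y ∈ Ω, dist x y ≤ D) {v : E → ℝ} {g : E → ℝ≥0∞}
    (hg : Measurable g) (hvg : IsUpperGradientOn Ω v g) {S : Set E} (hS : MeasurableSet S)
    (hvS : ∀ x ∉ S, v x = 0) {s : ℝ} (hs0 : 0 < s) (hs1 : s ≤ 1)
    (hSs : ν S ≤ ENNReal.ofReal (s ^ k)) (hS2 : ν S ≤ 1 / 2) :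
    ∫⁻ x, ENNReal.ofReal |v x| ∂ν ≤ ENNReal.ofReal (2 ^ (k + 1) * D * s) * ∫⁻ x, g x ∂ν := by
  set I := ∫⁻ x, g x ∂ν with hI
  set V := ∫⁻ x, ENNReal.ofReal |v x| ∂ν with hV
  have hΩne : ∃ x, x ∈ Ω := hΩ.exists
  have hD0 : 0 ≤ D := by
    obtain ⟨x, hx⟩ := hΩne
    simpa using hD x hx x hx
  have hVS : V = ∫⁻ y in S, ENNReal.ofReal |v y| ∂ν := by
    rw [hV, ← lintegral_add_compl _ hS, setLIntegral_congr_fun hS.compl (g := fun _ => 0)]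
    · simp
    · intro x hx
      simp [hvS x hx]
  have hhalf : (1 / 2 : ℝ≥0∞) ≤ ν Sᶜ := by
    rw [prob_compl_eq_one_sub hS]
    refine le_trans ?_ (tsub_le_tsub_left hS2 1)
    simp
  set J : ℝ → ℝ≥0∞ := fun t => ∫⁻ x in Sᶜ, ∫⁻ y in S, g ((1 - t) • x + t • y) ∂ν ∂ν with hJ
  have hVJ : V * ν Sᶜ ≤ ENNReal.ofReal D * ∫⁻ t in Ioo (0 : ℝ) 1, J t := by
    rw [hJ, ← lintegral_segment_swap _ _ _ hg, ← lintegral_const_mul' _ _ ENNReal.ofReal_ne_top,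
      hVS, ← setLIntegral_const]
    refine lintegral_mono_ae ?_
    filter_upwards [ae_restrict_of_ae hΩ, ae_restrict_mem hS.compl] with x hx hxS
    rw [← lintegral_const_mul' _ _ ENNReal.ofReal_ne_top]
    refine lintegral_mono_ae ?_
    filter_upwards [ae_restrict_of_ae hΩ] with y hy
    have := hvg x hx y hy
    rw [hvS x hxS, sub_zero] at this
    refine this.trans ?_
    gcongr
    exact hD x hx y hy
  set δ := s / 2 with hδ
  have hδ0 : 0 < δ := by positivity
  have hδ1 : δ ≤ 1 / 2 := by rw [hδ]; linarith
  have hJ1 : ∫⁻ t in Ioo (1 - δ) 1, J t ≤ ENNReal.ofReal (2 ^ k * δ) * I := by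
    calc ∫⁻ t in Ioo (1 - δ) 1, J t ≤ ∫⁻ _ in Ioo (1 - δ) 1, ENNReal.ofReal (2 ^ k) * I := by
          refine setLIntegral_mono' measurableSet_Ioo fun t ht => ?_
          have ht2 : 1 / 2 ≤ t := by linarith [ht.1]
          refine (h.setLIntegral_setLIntegral_le_left hΩ Sᶜ S (by linarith) ht.2.le hg).trans ?_
          refine (mul_le_of_le_one_left' prob_le_one).trans ?_
          gcongr
          rw [← inv_pow]
          gcongr
          rw [inv_le_comm₀ (by linarith) (by norm_num)]
          linarith
      _ = _ := by
          rw [setLIntegral_const, Real.volume_Ioo, mul_right_comm,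
            ← ENNReal.ofReal_mul (by positivity)]
          congr 3
          ring
  have hJ2 : ∫⁻ t in Ioc 0 (1 - δ), J t ≤ ENNReal.ofReal (2 ^ k * δ) * I := by
    calc ∫⁻ t in Ioc 0 (1 - δ), J t
        ≤ ∫⁻ t in Ioc 0 (1 - δ), ENNReal.ofReal (s ^ k * (δ ^ (k - 2))⁻¹) * I *
            ENNReal.ofReal ((1 - t) ^ 2)⁻¹ := by
          refine setLIntegral_mono' measurableSet_Ioc fun t ht => ?_
          have ht2 : δ ≤ 1 - t := by linarith [ht.2]
          refine (h.setLIntegral_setLIntegral_le_right hΩ Sᶜ S ht.1.le (by linarith) hg).trans ?_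
          refine (mul_le_mul_left hSs _).trans ?_
          rw [← mul_assoc, mul_right_comm _ I, ← ENNReal.ofReal_mul (by positivity),
            ← ENNReal.ofReal_mul (by positivity), mul_assoc (s ^ k), ← mul_inv]
          have hprod : 0 < δ ^ (k - 2) * (1 - t) ^ 2 :=
            mul_pos (by positivity) (pow_pos (by linarith) 2)
          gcongr
          calc δ ^ (k - 2) * (1 - t) ^ 2 ≤ (1 - t) ^ (k - 2) * (1 - t) ^ 2 := by gcongr
            _ = (1 - t) ^ k := by rw [← pow_add]; congr 1; omega
      _ = ENNReal.ofReal (s ^ k * (δ ^ (k - 2))⁻¹) * I *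
            ∫⁻ t in Ioc 0 (1 - δ), ENNReal.ofReal ((1 - t) ^ 2)⁻¹ := by
          rw [lintegral_const_mul _ (by fun_prop)]
      _ ≤ ENNReal.ofReal (s ^ k * (δ ^ (k - 2))⁻¹) * I * ENNReal.ofReal δ⁻¹ := by
          gcongr
          exact lintegral_inv_sq_one_sub_le hδ0 (by linarith)
      _ = _ := by
          rw [mul_right_comm, ← ENNReal.ofReal_mul (by positivity)]
          congr 2
          obtain ⟨j, rfl⟩ := Nat.exists_eq_add_of_le' hk
          have : s = 2 * δ := by rw [hδ]; ring
          rw [this, Nat.add_sub_cancel, mul_pow]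
          field_simp
          ring
  have hJtot : ∫⁻ t in Ioo (0 : ℝ) 1, J t ≤ ENNReal.ofReal (2 ^ k * s) * I := by
    calc ∫⁻ t in Ioo (0 : ℝ) 1, J t
        ≤ ∫⁻ t in Ioc 0 (1 - δ) ∪ Ioo (1 - δ) 1, J t := by
          refine lintegral_mono_set fun t ht => ?_
          rcases le_or_gt t (1 - δ) with h1 | h1
          · exact Or.inl ⟨ht.1, h1⟩
          · exact Or.inr ⟨h1, ht.2⟩
      _ ≤ _ := lintegral_union_le _ _ _
      _ ≤ _ := add_le_add hJ2 hJ1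
      _ = _ := by
          rw [← add_mul, ← ENNReal.ofReal_add (by positivity) (by positivity)]
          congr 2
          rw [hδ]; ring
  have h2 : V = 2 * (V * (1 / 2)) := by
    rw [mul_left_comm, one_div, ENNReal.mul_inv_cancel (by simp) (by simp), mul_one]
  calc V = 2 * (V * (1 / 2)) := h2
    _ ≤ 2 * (ENNReal.ofReal D * (ENNReal.ofReal (2 ^ k * s) * I)) := by
        refine mul_le_mul_right ?_ _
        exact (mul_le_mul_right hhalf _).trans (hVJ.trans (mul_le_mul_right hJtot _))
    _ = _ := by
        rw [← mul_assoc, ← mul_assoc, ← ENNReal.ofReal_ofNat 2,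
          ← ENNReal.ofReal_mul (by positivity), ← ENNReal.ofReal_mul (by positivity)]
        congr 2
        ring

/-- A crude `L^p` Poincaré inequality, in double-integral form. -/
theorem HasDilationBound.lintegral_lintegral_rpow_le [IsProbabilityMeasure ν]
    (h : HasDilationBound k Ω ν) (hΩ : ∀ᵐ x ∂ν, x ∈ Ω) {D : ℝ}
    (hD : ∀ x ∈ Ω, ∀ y ∈ Ω, dist x y ≤ D) {p : ℝ} (hp : 1 < p) {v : E → ℝ} {g : E → ℝ≥0∞}
    (hg : Measurable g) (hvg : IsUpperGradientOn Ω v g) :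
    ∫⁻ x, ∫⁻ y, ENNReal.ofReal |v y - v x| ^ p ∂ν ∂ν ≤
      ENNReal.ofReal D ^ p * (ENNReal.ofReal (2 ^ k) * ∫⁻ x, g x ^ p ∂ν) := by
  have hp0 : 0 ≤ p := by linarith
  have hgp : Measurable fun x => g x ^ p := hg.pow_const p
  have hpt : ∀ x ∈ Ω, ∀ y ∈ Ω, ENNReal.ofReal |v y - v x| ^ p ≤
      ENNReal.ofReal D ^ p * ∫⁻ t in Ioo (0 : ℝ) 1, g ((1 - t) • x + t • y) ^ p := by
    intro x hx y hy
    have hj : (∫⁻ t in Ioo (0 : ℝ) 1, g ((1 - t) • x + t • y)) ^ p ≤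
        ∫⁻ t in Ioo (0 : ℝ) 1, g ((1 - t) • x + t • y) ^ p := by
      have hq := Real.HolderConjugate.conjExponent hp
      have := ENNReal.lintegral_mul_le_Lp_mul_Lq (volume.restrict (Ioo (0 : ℝ) 1)) hq
        (f := fun t => g ((1 - t) • x + t • y)) (g := fun _ => 1) (by fun_prop) (by fun_prop)
      simp only [Pi.mul_apply, mul_one, ENNReal.one_rpow, lintegral_const, Measure.restrict_apply
        MeasurableSet.univ, univ_inter, Real.volume_Ioo, sub_zero, ENNReal.ofReal_one] at this
      calc _ ≤ ((∫⁻ t in Ioo (0 : ℝ) 1, g ((1 - t) • x + t • y) ^ p) ^ (1 / p)) ^ p := by gcongr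
        _ = _ := by rw [← ENNReal.rpow_mul, one_div_mul_cancel (by linarith), ENNReal.rpow_one]
    calc ENNReal.ofReal |v y - v x| ^ p
        ≤ (ENNReal.ofReal D * ∫⁻ t in Ioo (0 : ℝ) 1, g ((1 - t) • x + t • y)) ^ p := by
          gcongr
          refine (hvg x hx y hy).trans ?_
          gcongr
          exact hD x hx y hy
      _ = ENNReal.ofReal D ^ p * (∫⁻ t in Ioo (0 : ℝ) 1, g ((1 - t) • x + t • y)) ^ p :=
          ENNReal.mul_rpow_of_nonneg _ _ hp0
      _ ≤ _ := by gcongr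
  have hDp : ENNReal.ofReal D ^ p ≠ ∞ := ENNReal.rpow_ne_top_of_nonneg hp0 ENNReal.ofReal_ne_top
  calc ∫⁻ x, ∫⁻ y, ENNReal.ofReal |v y - v x| ^ p ∂ν ∂ν
      ≤ ∫⁻ x, ∫⁻ y, ENNReal.ofReal D ^ p *
          (∫⁻ t in Ioo (0 : ℝ) 1, g ((1 - t) • x + t • y) ^ p) ∂ν ∂ν := by
        refine lintegral_mono_ae ?_
        filter_upwards [hΩ] with x hx
        refine lintegral_mono_ae ?_
        filter_upwards [hΩ] with y hy
        exact hpt x hx y hy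
    _ = ENNReal.ofReal D ^ p * ∫⁻ x in univ, ∫⁻ y in univ,
          (∫⁻ t in Ioo (0 : ℝ) 1, g ((1 - t) • x + t • y) ^ p) ∂ν ∂ν := by
        simp_rw [lintegral_const_mul' _ _ hDp, Measure.restrict_univ]
    _ ≤ _ := by
        rw [lintegral_segment_swap _ _ _ hgp]
        gcongr
        calc _ ≤ ∫⁻ _ in Ioo (0 : ℝ) 1, ENNReal.ofReal (2 ^ k) * ∫⁻ x, g x ^ p ∂ν := by
              refine setLIntegral_mono' measurableSet_Ioo fun t ht => ?_
              have key : ∀ r : ℝ, 1 / 2 ≤ r → (r ^ k)⁻¹ ≤ 2 ^ k := by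
                intro r hr
                rw [← inv_pow]
                gcongr
                rw [inv_le_comm₀ (by linarith) (by norm_num)]
                linarith
              rcases le_total (1 / 2) t with h2 | h2
              · refine (h.setLIntegral_setLIntegral_le_left hΩ univ univ ht.1 ht.2.le hgp).trans ?_
                rw [measure_univ, one_mul]
                gcongr
                exact key t h2
              · refine (h.setLIntegral_setLIntegral_le_right hΩ univ univ ht.1.le ht.2 hgp).trans ?_
                rw [measure_univ, one_mul]
                gcongr
                exact key _ (by linarith)
          _ = _ := by simp

end DilationBound

theorem pow_succ_sub_pow_succ_le {a b : ℝ} (hb : 0 ≤ b) (hab : b ≤ a) (n : ℕ) :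
    a ^ (n + 1) - b ^ (n + 1) ≤ (n + 1) * a ^ n * (a - b) := by
  induction n with
  | zero => simp
  | succ n ih =>
    have h1 : b ^ (n + 1) ≤ a ^ (n + 1) := pow_le_pow_left₀ hb hab _
    have h2 := mul_le_mul_of_nonneg_left ih (hb.trans hab)
    have h3 := mul_le_mul_of_nonneg_right h1 (sub_nonneg.2 hab)
    have e : a ^ (n + 1 + 1) - b ^ (n + 1 + 1) =
        a * (a ^ (n + 1) - b ^ (n + 1)) + b ^ (n + 1) * (a - b) := by ring
    rw [e]
    push_cast
    calc _ ≤ a * ((n + 1) * a ^ n * (a - b)) + a ^ (n + 1) * (a - b) := add_le_add h2 h3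
      _ = _ := by ring

/-- A distribution function which controls the excess above each level by a superlinear power
must reach zero quickly. -/
theorem pow_le_mul_integral_of_excess_le {α : Type*} [MeasurableSpace α] {ν : Measure α}
    [IsProbabilityMeasure ν] {U : α → ℝ} (hU : Measurable U) (hUi : Integrable U ν)
    {k : ℕ} (hk : 0 < k) {L t₀ T : ℝ} (hL : 0 < L) (ht : t₀ ≤ T) (hpos : 0 < ν.real {x | T < U x})
    (hb : ∀ t ∈ Ico t₀ T, ∫ x, max (U x - t) 0 ∂ν ≤
      L * (ν.real {x | t < U x} * ν.real {x | t < U x} ^ (1 / (k : ℝ)))) :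
    ((T - t₀) / (k + 1)) ^ (k + 1) ≤ L ^ k * ∫ x, max (U x - t₀) 0 ∂ν := by
  set G : ℝ → ℝ := fun t => ∫ x, max (U x - t) 0 ∂ν with hG
  set a : ℝ → ℝ := fun t => ν.real {x | t < U x} with ha
  have hintegr : ∀ t, Integrable (fun x => max (U x - t) 0) ν := fun t =>
    (hUi.sub (integrable_const t)).pos_part
  have hdiff : ∀ x z, x ≤ z → (z - x) * a z ≤ G x - G z := by
    intro x z hxz
    have hm : MeasurableSet {y | z < U y} := measurableSet_lt measurable_const hU
    rw [hG, ← integral_sub (hintegr x) (hintegr z)]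
    calc (z - x) * a z = ∫ y, {y | z < U y}.indicator (fun _ => z - x) y ∂ν := by
          rw [integral_indicator_const _ hm, smul_eq_mul, mul_comm]
      _ ≤ _ := by
          refine integral_mono ((integrable_const _).indicator hm) ((hintegr x).sub (hintegr z)) ?_
          intro y
          by_cases hy : z < U y
          · simp only [mem_ofPred_eq, hy, indicator_of_mem]
            rw [max_eq_left (by linarith), max_eq_left (by linarith)]
            linarith
          · simp only [mem_ofPred_eq, hy, not_false_eq_true, indicator_of_notMem]
            have : max (U y - z) 0 ≤ max (U y - x) 0 := max_le_max (by linarith) le_rfl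
            linarith
  have hG0 : ∀ t, 0 ≤ G t := fun t => integral_nonneg fun x => le_max_right _ _
  have hGlip : LipschitzWith 1 G := by
    refine LipschitzWith.of_dist_le_mul fun x z => ?_
    rw [NNReal.coe_one, one_mul, dist_eq_norm, hG, ← integral_sub (hintegr x) (hintegr z)]
    refine (norm_integral_le_of_norm_le_const (C := dist x z)
      (Eventually.of_forall fun y => ?_)).trans
      (by simp)
    refine (abs_max_sub_max_le_abs _ _ _).trans ?_
    rw [Real.dist_eq, abs_sub_comm x z]
    exact le_of_eq (by congr 1; ring)
  have haT : ∀ t, t ≤ T → 0 < a t := fun t ht => hpos.trans_le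
    (measureReal_mono fun x (hx : T < U x) => ht.trans_lt hx)
  have hGpos : ∀ t, t < T → 0 < G t := by
    intro t ht
    have := hdiff t T ht.le
    have h2 : 0 < (T - t) * a T := mul_pos (by linarith) hpos
    linarith [hG0 T]
  set q : ℝ := ((k + 1 : ℕ) : ℝ)⁻¹ with hq
  set y : ℝ → ℝ := fun t => G t ^ q with hy
  set l : ℝ := L ^ q with hl
  have hl0 : 0 < l := Real.rpow_pos_of_pos hL _
  have hlk : l ^ (k + 1) = L := Real.rpow_inv_natCast_pow hL.le (by omega)
  have hyk : ∀ t, y t ^ (k + 1) = G t := fun t => Real.rpow_inv_natCast_pow (hG0 t) (by omega)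
  have hy0 : ∀ t, 0 ≤ y t := fun t => Real.rpow_nonneg (hG0 t) _
  have hypos : ∀ t, t < T → 0 < y t := fun t ht => Real.rpow_pos_of_pos (hGpos t ht) _
  have hyc : Continuous y := hGlip.continuous.rpow_const fun _ => Or.inr (by positivity)
  have hya : ∀ t ∈ Ico t₀ T, (y t / l) ^ k ≤ a t := by
    intro t ht
    have hat := haT t ht.2.le
    set b := a t ^ (1 / (k : ℝ)) with hb'
    have hb0 : 0 ≤ b := Real.rpow_nonneg hat.le _
    have hbk : b ^ k = a t := by
      rw [hb', one_div]
      exact Real.rpow_inv_natCast_pow hat.le (by omega)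
    have h1 : (y t / l) ^ (k + 1) ≤ b ^ (k + 1) := by
      rw [div_pow, hyk, hlk, div_le_iff₀ hL, pow_succ, hbk, mul_comm]
      exact hb t ht
    have h2 : y t / l ≤ b := le_of_pow_le_pow_left₀ (by omega) hb0 h1
    calc (y t / l) ^ k ≤ b ^ k := pow_le_pow_left₀ (div_nonneg (hy0 t) hl0.le) h2 _
      _ = a t := hbk
  set β : ℝ := (l ^ k)⁻¹ / (k + 1) with hβ
  have hmain : y T ≤ y t₀ - β * (T - t₀) := by
    refine image_le_of_liminf_slope_right_le_deriv_boundary (f := y) (a := t₀) (b := T)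
      (B := fun x => y t₀ - β * (x - t₀)) (B' := fun _ => -β) hyc.continuousOn (by simp)
      (by fun_prop) ?_ ?_ (right_mem_Icc.2 ht)
    · intro x _
      have := (((hasDerivAt_id x).sub_const t₀).const_mul β).const_sub (y t₀)
      simpa using this.hasDerivWithinAt
    · intro x hx r hr
      have hlim : Tendsto (fun z => -((y z / l) ^ k / ((k + 1) * y x ^ k))) (𝓝[>] x) (𝓝 (-β)) := by
        have hc : Continuous fun z => -((y z / l) ^ k / ((k + 1) * y x ^ k)) := by fun_prop
        have h0 := (hc.tendsto x).mono_left (nhdsWithin_le_nhds (s := Ioi x))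
        convert h0 using 2
        have := (hypos x hx.2).ne'
        rw [hβ, div_pow]
        field_simp
      refine Eventually.frequently ?_
      filter_upwards [hlim.eventually_lt_const hr, Ioo_mem_nhdsGT hx.2] with z hz hxz
      refine lt_of_le_of_lt ?_ hz
      have hyx := hypos x hx.2
      have hzx : 0 < z - x := sub_pos.2 hxz.1
      have h1 := hdiff x z hxz.1.le
      have h2 := hya z ⟨hx.1.trans hxz.1.le, hxz.2⟩
      have hGle : G z ≤ G x := by
        have := mul_nonneg hzx.le (haT z hxz.2.le).le
        linarith
      have hyle : y z ≤ y x := Real.rpow_le_rpow (hG0 z) hGle (by positivity)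
      have h3 := pow_succ_sub_pow_succ_le (hy0 z) hyle k
      rw [hyk, hyk] at h3
      have h4 : (z - x) * (y z / l) ^ k ≤ (k + 1) * y x ^ k * (y x - y z) :=
        (mul_le_mul_of_nonneg_left h2 hzx.le).trans (h1.trans h3)
      rw [slope_def_field, div_le_iff₀ hzx, neg_mul, le_neg, neg_sub, div_mul_eq_mul_div,
        div_le_iff₀ (by positivity)]
      linarith
  have hfin : β * (T - t₀) ≤ y t₀ := by linarith [hy0 T]
  have hβ0 : 0 ≤ β * (T - t₀) := mul_nonneg (by positivity) (by linarith)
  have hpow := pow_le_pow_left₀ hβ0 hfin (k + 1)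
  rw [hyk] at hpow
  calc ((T - t₀) / (k + 1)) ^ (k + 1) = L ^ k * (β * (T - t₀)) ^ (k + 1) := by
        rw [← hlk, hβ]
        rw [← pow_mul, mul_comm (k + 1) k, pow_mul, ← mul_pow]
        congr 1
        field_simp
    _ ≤ _ := by gcongr

section SignedPower

variable {p : ℝ}

theorem abs_rpow_sub_two_mul_self_mul_self (hp : 1 < p) (s : ℝ) :
    |s| ^ (p - 2) * s * s = |s| ^ p := by
  rcases eq_or_ne s 0 with rfl | hs
  · simp [Real.zero_rpow (by linarith : p ≠ 0)]
  · have h : 0 < |s| := abs_pos.2 hs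
    rw [mul_assoc, ← abs_mul_abs_self s, ← sq, ← Real.rpow_natCast, ← Real.rpow_add h]
    norm_num

theorem abs_abs_rpow_sub_two_mul_self (hp : 1 < p) (s : ℝ) :
    |(|s| ^ (p - 2) * s)| = |s| ^ (p - 1) := by
  rcases eq_or_ne s 0 with rfl | hs
  · simp [Real.zero_rpow (by linarith : p - 1 ≠ 0)]
  · have h : 0 < |s| := abs_pos.2 hs
    rw [abs_mul, abs_of_nonneg (Real.rpow_nonneg h.le _), ← Real.rpow_add_one h.ne']
    congr 1
    ring

theorem continuous_abs_rpow_sub_two_mul_self (hp : 1 < p) :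
    Continuous fun s : ℝ => |s| ^ (p - 2) * s := by
  have h : (fun s : ℝ => |s| ^ (p - 2) * s) =
      fun s => max s 0 ^ (p - 1) - max (-s) 0 ^ (p - 1) := by
    funext s
    have h0 : (0 : ℝ) ^ (p - 1) = 0 := Real.zero_rpow (by linarith)
    have hs : p - 1 = p - 2 + 1 := by ring
    rcases lt_trichotomy s 0 with h | rfl | h
    · rw [max_eq_right h.le, max_eq_left (by linarith), h0, abs_of_neg h, hs,
        Real.rpow_add_one (by linarith)]
      ring
    · simp [h0]
    · rw [max_eq_left h.le, max_eq_right (by linarith), h0, abs_of_pos h, hs,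
        Real.rpow_add_one h.ne']
      ring
  rw [h]
  have hp1 : 0 ≤ p - 1 := by linarith
  exact ((continuous_id.max continuous_const).rpow_const fun _ => Or.inr hp1).sub
    ((continuous_neg.max continuous_const).rpow_const fun _ => Or.inr hp1)

theorem abs_rpow_add_tangent_le (hp : 1 < p) (a b : ℝ) :
    |a| ^ p + p * (|a| ^ (p - 2) * a * (b - a)) ≤ |b| ^ p := by
  have hq := Real.HolderConjugate.conjExponent hp
  have hp0 : 0 < p := by linarith
  have hy := Real.young_inequality_of_nonneg (abs_nonneg b)
    (Real.rpow_nonneg (abs_nonneg a) (p - 1)) hq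
  have hpow : (|a| ^ (p - 1)) ^ (p.conjExponent) = |a| ^ p := by
    rw [← Real.rpow_mul (abs_nonneg a), Real.conjExponent]
    congr 1
    field_simp [(by linarith : p - 1 ≠ 0)]
  rw [hpow, Real.conjExponent] at hy
  have h1 : |a| ^ (p - 2) * a * b ≤ |b| * |a| ^ (p - 1) := by
    refine (le_abs_self _).trans ?_
    rw [abs_mul, abs_abs_rpow_sub_two_mul_self hp, mul_comm]
  have h2 := h1.trans hy
  have h3 := abs_rpow_sub_two_mul_self_mul_self hp a
  have h4 : p * (|b| ^ p / p + |a| ^ p / (p / (p - 1))) = |b| ^ p + (p - 1) * |a| ^ p := by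
    have : p - 1 ≠ 0 := by linarith
    field_simp
  have h5 := mul_le_mul_of_nonneg_left h2 hp0.le
  rw [h4] at h5
  rw [mul_sub, h3]
  linarith

end SignedPower

section Minimality

variable {E : Type*} [MeasurableSpace E] {p : ℝ} {ν : Measure E}

theorem exists_integral_signed_rpow_sub_eq_zero [IsProbabilityMeasure ν] (hp : 1 < p)
    {f : E → ℝ} (hf : Measurable f) {B : ℝ} (hB : ∀ᵐ x ∂ν, |f x| ≤ B) :
    ∃ c, ∫ x, |f x - c| ^ (p - 2) * (f x - c) ∂ν = 0 := by
  have hB0 : 0 ≤ B := by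
    obtain ⟨x, hx⟩ := hB.exists
    exact (abs_nonneg _).trans hx
  have hΨ := continuous_abs_rpow_sub_two_mul_self hp
  have hcont : ContinuousOn (fun c => ∫ x, |f x - c| ^ (p - 2) * (f x - c) ∂ν) (Icc (-B) B) := by
    refine continuousOn_of_dominated (bound := fun _ => (2 * B) ^ (p - 1)) ?_ ?_
      (integrable_const _) ?_
    · intro c _
      exact (hΨ.measurable.comp (hf.sub_const c)).aestronglyMeasurable
    · intro c hc
      filter_upwards [hB] with x hx
      rw [Real.norm_eq_abs, abs_abs_rpow_sub_two_mul_self hp]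
      refine Real.rpow_le_rpow (abs_nonneg _) ?_ (by linarith)
      have := abs_sub (f x) c
      have := abs_le.2 hc
      linarith
    · refine Eventually.of_forall fun x => Continuous.continuousOn ?_
      exact hΨ.comp (continuous_const.sub continuous_id)
  have h0 : (0 : ℝ) ∈ Icc (∫ x, |f x - B| ^ (p - 2) * (f x - B) ∂ν)
      (∫ x, |f x - -B| ^ (p - 2) * (f x - -B) ∂ν) := by
    constructor
    · refine integral_nonpos_of_ae ?_
      filter_upwards [hB] with x hx
      exact mul_nonpos_of_nonneg_of_nonpos (Real.rpow_nonneg (abs_nonneg _) _)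
        (by linarith [(abs_le.1 hx).2])
    · refine integral_nonneg_of_ae ?_
      filter_upwards [hB] with x hx
      exact mul_nonneg (Real.rpow_nonneg (abs_nonneg _) _) (by linarith [(abs_le.1 hx).1])
  obtain ⟨c, _, hc⟩ := intermediate_value_Icc' (by linarith) hcont h0
  exact ⟨c, hc⟩

theorem integrable_abs_rpow_sub_one [IsProbabilityMeasure ν] (hp : 1 < p) {u : E → ℝ}
    (hu : Measurable u) (hup : Integrable (fun x => |u x| ^ p) ν) :
    Integrable (fun x => |u x| ^ (p - 1)) ν := by
  refine ((integrable_const (1 : ℝ)).add hup).mono' ?_ (Eventually.of_forall fun x => ?_)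
  · exact (hu.abs.pow_const _).aestronglyMeasurable
  · rw [Real.norm_of_nonneg (Real.rpow_nonneg (abs_nonneg _) _), Pi.add_apply]
    rcases le_total |u x| 1 with h | h
    · have := Real.rpow_le_one (abs_nonneg _) h (by linarith : 0 ≤ p - 1)
      have := Real.rpow_nonneg (abs_nonneg (u x)) p
      linarith
    · have := Real.rpow_le_rpow_of_exponent_le h (by linarith : p - 1 ≤ p)
      linarith

variable [NormedAddCommGroup E] [NormedSpace ℝ E]

/-- `μ` is a Poincaré constant for globally Lipschitz functions with zero `p`-mean. -/
def IsNeumannBound (p μ : ℝ) (ν : Measure E) : Prop :=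
  ∀ (f : E → ℝ) (K : ℝ≥0), LipschitzWith K f → ∫ x, |f x| ^ (p - 2) * f x ∂ν = 0 →
    μ * ∫ x, |f x| ^ p ∂ν ≤ ∫ x, ‖fderiv ℝ f x‖ ^ p ∂ν

theorem IsNeumannBound.le_of_lipschitzWith [BorelSpace E] [IsProbabilityMeasure ν] (hp : 1 < p)
    {μ : ℝ} (hμ0 : 0 ≤ μ) (hμ : IsNeumannBound p μ ν) {u : E → ℝ} (hu : Measurable u)
    (hup : Integrable (fun x => |u x| ^ p) ν)
    (hu0 : ∫ x, |u x| ^ (p - 2) * u x ∂ν = 0) {f : E → ℝ} {K : ℝ≥0} (hf : LipschitzWith K f)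
    {B : ℝ} (hB : ∀ᵐ x ∂ν, |f x| ≤ B) :
    μ * (∫ x, |u x| ^ p ∂ν - p * ∫ x, |u x| ^ (p - 2) * u x * (u x - f x) ∂ν) ≤
      ∫ x, ‖fderiv ℝ f x‖ ^ p ∂ν := by
  have hfm : Measurable f := hf.continuous.measurable
  obtain ⟨c, hc⟩ := exists_integral_signed_rpow_sub_eq_zero hp hfm hB
  have hfc : LipschitzWith K fun x => f x - c := by
    refine LipschitzWith.of_dist_le_mul fun x y => ?_
    simpa using hf.dist_le_mul x y
  have h1 := hμ _ K hfc hc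
  simp only [fderiv_sub_const] at h1
  refine le_trans (mul_le_mul_of_nonneg_left ?_ hμ0) h1
  have hΨ := (continuous_abs_rpow_sub_two_mul_self hp).measurable
  have hΨu : Integrable (fun x => |u x| ^ (p - 2) * u x) ν := by
    refine (integrable_abs_rpow_sub_one hp hu hup).mono' (hΨ.comp hu).aestronglyMeasurable ?_
    exact Eventually.of_forall fun x => (abs_abs_rpow_sub_two_mul_self hp _).le
  have hΨf : Integrable (fun x => |u x| ^ (p - 2) * u x * f x) ν := by
    refine ((integrable_abs_rpow_sub_one hp hu hup).mul_const B).mono'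
      ((hΨ.comp hu).mul hfm).aestronglyMeasurable ?_
    filter_upwards [hB] with x hx
    rw [Real.norm_eq_abs, abs_mul, abs_abs_rpow_sub_two_mul_self hp]
    gcongr
  have hΨuf : Integrable (fun x => |u x| ^ (p - 2) * u x * (u x - f x)) ν := by
    have : Integrable (fun x => |u x| ^ p - |u x| ^ (p - 2) * u x * f x) ν := hup.sub hΨf
    refine this.congr (Eventually.of_forall fun x => ?_)
    change |u x| ^ p - |u x| ^ (p - 2) * u x * f x = |u x| ^ (p - 2) * u x * (u x - f x)
    rw [mul_sub, abs_rpow_sub_two_mul_self_mul_self hp]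
  have hfp : Integrable (fun x => |f x - c| ^ p) ν := by
    refine (integrable_const ((B + |c|) ^ p)).mono'
      ((hfm.sub_const c).abs.pow_const p).aestronglyMeasurable ?_
    filter_upwards [hB] with x hx
    rw [Real.norm_of_nonneg (Real.rpow_nonneg (abs_nonneg _) _)]
    refine Real.rpow_le_rpow (abs_nonneg _) ?_ (by linarith)
    linarith [abs_sub (f x) c]
  have hcalc : ∫ x, |u x| ^ p ∂ν - p * ∫ x, |u x| ^ (p - 2) * u x * (u x - f x) ∂ν =
      ∫ x, (|u x| ^ p - p * (|u x| ^ (p - 2) * u x * (u x - f x)) -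
        p * c * (|u x| ^ (p - 2) * u x)) ∂ν := by
    have hA : Integrable (fun x => |u x| ^ p - p * (|u x| ^ (p - 2) * u x * (u x - f x))) ν :=
      hup.sub (hΨuf.const_mul p)
    rw [integral_sub hA (hΨu.const_mul _), integral_sub hup (hΨuf.const_mul p),
      integral_const_mul, integral_const_mul, hu0]
    ring
  rw [hcalc]
  refine integral_mono ((hup.sub (hΨuf.const_mul p)).sub (hΨu.const_mul _)) hfp fun x => ?_
  refine le_of_eq_of_le ?_ (abs_rpow_add_tangent_le hp (u x) (f x - c))
  ring

end Minimality

section LocallyLipschitz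

theorem LocallyLipschitz.comp_locallyLipschitzOn {α β γ : Type*} [PseudoEMetricSpace α]
    [PseudoEMetricSpace β] [PseudoEMetricSpace γ] {s : Set α} {F : β → γ} {u : α → β}
    (hF : LocallyLipschitz F) (hu : LocallyLipschitzOn s u) :
    LocallyLipschitzOn s fun x => F (u x) := by
  rw [locallyLipschitzOn_iff_restrict] at hu ⊢
  exact hF.comp hu

variable {E : Type*} [NormedAddCommGroup E] [NormedSpace ℝ E] {Ω : Set E}

theorem LocallyLipschitzOn.ae_differentiableAt [FiniteDimensional ℝ E] [MeasurableSpace E]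
    [BorelSpace E] (hopen : IsOpen Ω) {u : E → ℝ} (hu : LocallyLipschitzOn Ω u) (vol : Measure E)
    [vol.IsAddHaarMeasure] : ∀ᵐ x ∂vol, x ∈ Ω → DifferentiableAt ℝ u x := by
  rw [ae_iff]
  refine measure_null_of_locally_null _ fun x hx => ?_
  simp only [mem_ofPred_eq, Classical.not_imp] at hx
  obtain ⟨K, t, ht, hut⟩ := hu hx.1
  rw [hopen.nhdsWithin_eq hx.1] at ht
  have h := (hut.mono interior_subset).ae_differentiableWithinAt_of_mem (μ := vol)
  rw [ae_iff] at h
  refine ⟨{y | ¬(y ∈ Ω → DifferentiableAt ℝ u y)} ∩ interior t, ?_, measure_mono_null ?_ h⟩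
  · exact inter_mem self_mem_nhdsWithin (mem_nhdsWithin_of_mem_nhds (interior_mem_nhds.2 ht))
  · rintro y ⟨hy, hyt⟩ hy'
    exact hy fun _ => (hy' hyt).differentiableAt (isOpen_interior.mem_nhds hyt)

theorem locallyLipschitz_clip (t : ℝ) : LocallyLipschitz fun s : ℝ => max (min s t) (-t) := by
  have h := LipschitzWith.id (α := ℝ)
  exact ((h.min_const t).max_const (-t)).locallyLipschitz

theorem locallyLipschitz_max_abs (t : ℝ) : LocallyLipschitz fun s : ℝ => max |s| t :=
  (LipschitzWith.max_const lipschitzWith_one_norm t).locallyLipschitz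

theorem norm_fderiv_clip {u : E → ℝ} {x : E} (hu : ContinuousAt u x) {t : ℝ} (ht : 0 < t) :
    ‖fderiv ℝ (fun y => max (min (u y) t) (-t)) x‖ = if |u x| < t then ‖fderiv ℝ u x‖ else 0 := by
  split_ifs with h
  · rw [abs_lt] at h
    congr 1
    refine EventuallyEq.fderiv_eq ?_
    filter_upwards [hu.eventually (lt_mem_nhds h.1), hu.eventually (gt_mem_nhds h.2)] with y h1 h2
    rw [min_eq_left h2.le, max_eq_left h1.le]
  · rw [norm_eq_zero]
    rw [abs_lt, not_and_or, not_lt, not_lt] at h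
    rcases h with h | h
    · refine IsLocalMin.fderiv_eq_zero (Eventually.of_forall fun y => ?_)
      change max (min (u x) t) (-t) ≤ _
      rw [min_eq_left (by linarith), max_eq_right h]
      exact le_max_right _ _
    · refine IsLocalMax.fderiv_eq_zero (Eventually.of_forall fun y => ?_)
      change _ ≤ max (min (u x) t) (-t)
      rw [min_eq_right h, max_eq_left (by linarith)]
      exact max_le (min_le_right _ _) (by linarith)

theorem norm_fderiv_max_abs {u : E → ℝ} {x : E} (hu : ContinuousAt u x) {t : ℝ} (ht : 0 < t) :
    ‖fderiv ℝ (fun y => max |u y| t) x‖ = if t < |u x| then ‖fderiv ℝ u x‖ else 0 := by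
  split_ifs with h
  · rcases lt_abs.1 h with h | h
    · congr 1
      refine EventuallyEq.fderiv_eq ?_
      filter_upwards [hu.eventually (lt_mem_nhds h)] with y hy
      rw [abs_of_pos (by linarith), max_eq_left hy.le]
    · rw [← norm_neg (fderiv ℝ u x), ← fderiv_fun_neg]
      congr 1
      refine EventuallyEq.fderiv_eq ?_
      filter_upwards [hu.neg.eventually (lt_mem_nhds h)] with y (hy : t < -u y)
      rw [abs_of_neg (by linarith), max_eq_left hy.le]
  · rw [norm_eq_zero]
    refine IsLocalMin.fderiv_eq_zero (Eventually.of_forall fun y => ?_)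
    change max |u x| t ≤ _
    rw [max_eq_right (not_lt.1 h)]
    exact le_max_right _ _

end LocallyLipschitz

section UpperGradient

variable {E : Type*} [NormedAddCommGroup E] [NormedSpace ℝ E] [MeasurableSpace E] [BorelSpace E]
  {Ω : Set E} {ν : Measure E}

theorem LocallyLipschitzOn.exists_isUpperGradientOn (hconv : Convex ℝ Ω) {v : E → ℝ}
    (hv : LocallyLipschitzOn Ω v) (hd : ∀ᵐ x ∂ν, DifferentiableAt ℝ v x) :
    ∃ g : E → ℝ≥0∞, Measurable g ∧ IsUpperGradientOn Ω v g ∧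
      ∀ᵐ x ∂ν, g x = ‖fderiv ℝ v x‖ₑ := by
  classical
  refine ⟨fun x => if DifferentiableAt ℝ v x then ‖fderiv ℝ v x‖ₑ else ∞, ?_, ?_, ?_⟩
  · exact Measurable.ite (measurableSet_of_differentiableAt ℝ v)
      (measurable_fderiv ℝ v).enorm measurable_const
  · refine hv.isUpperGradientOn hconv fun z _ => ?_
    by_cases h : DifferentiableAt ℝ v z <;> simp [h]
  · filter_upwards [hd] with x hx
    simp [hx]

end UpperGradient

section Competitor

variable {E : Type*} [NormedAddCommGroup E] [NormedSpace ℝ E] {Ω : Set E}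

theorem lipschitz_extension_dilation [FiniteDimensional ℝ E] (hopen : IsOpen Ω)
    (hconv : Convex ℝ Ω) (hbdd : Bornology.IsBounded Ω) {f : E → ℝ} (hf : LocallyLipschitzOn Ω f)
    {x₀ : E} (hx₀ : x₀ ∈ Ω) {r : ℝ} (hr0 : 0 < r) (hr1 : r < 1) :
    ∃ (K : ℝ≥0) (F : E → ℝ), LipschitzWith K F ∧
      EqOn (fun x => f ((1 - r) • x₀ + r • x)) F Ω := by
  have hδ : Continuous fun x : E => (1 - r) • x₀ + r • x := by fun_prop
  have hsub : (fun x : E => (1 - r) • x₀ + r • x) '' closure Ω ⊆ Ω := by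
    rintro _ ⟨x, hx, rfl⟩
    have := hconv.combo_interior_closure_mem_interior (x := x₀) (y := x)
      (by rwa [hopen.interior_eq]) hx (a := 1 - r) (b := r) (by linarith) hr0.le (by ring)
    rwa [hopen.interior_eq] at this
  have hcpt : IsCompact ((fun x : E => (1 - r) • x₀ + r • x) '' closure Ω) :=
    hbdd.isCompact_closure.image hδ
  obtain ⟨K, hK⟩ := (hf.mono hsub).exists_lipschitzOnWith_of_compact hcpt
  have hL : LipschitzWith (Real.toNNReal r) fun x : E => (1 - r) • x₀ + r • x := by
    refine LipschitzWith.of_dist_le_mul fun x y => ?_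
    rw [dist_add_left, dist_smul₀, Real.coe_toNNReal _ hr0.le, Real.norm_of_nonneg hr0.le]
  have hcomp := hK.comp hL.lipschitzOnWith (mapsTo_image _ (closure Ω))
  obtain ⟨F, hF, hFe⟩ := hcomp.extend_real
  exact ⟨_, F, hF, hFe.mono subset_closure⟩

variable [MeasurableSpace E] [BorelSpace E] {ν : Measure E} {p : ℝ} {k : ℕ}

theorem IsNeumannBound.le_of_locallyLipschitzOn [FiniteDimensional ℝ E] [IsProbabilityMeasure ν]
    (hp : 1 < p) (hopen : IsOpen Ω) (hconv : Convex ℝ Ω) (hbdd : Bornology.IsBounded Ω)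
    (hΩ : ∀ᵐ x ∂ν, x ∈ Ω) (h : HasDilationBound k Ω ν) {μ : ℝ} (hμ0 : 0 ≤ μ)
    (hμ : IsNeumannBound p μ ν) {u : E → ℝ} (hu : Measurable u)
    (hup : Integrable (fun x => |u x| ^ p) ν) (hu0 : ∫ x, |u x| ^ (p - 2) * u x ∂ν = 0)
    {f : E → ℝ} (hfm : Measurable f) (hf : LocallyLipschitzOn Ω f) {B : ℝ} (hB : ∀ x, |f x| ≤ B)
    (hfE : Integrable (fun x => ‖fderiv ℝ f x‖ ^ p) ν) :
    μ * (∫ x, |u x| ^ p ∂ν - p * ∫ x, |u x| ^ (p - 2) * u x * (u x - f x) ∂ν) ≤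
      ∫ x, ‖fderiv ℝ f x‖ ^ p ∂ν := by
  obtain ⟨x₀, hx₀⟩ := hΩ.exists
  have hp0 : 0 ≤ p := by linarith
  have hB0 : 0 ≤ B := (abs_nonneg _).trans (hB x₀)
  have hΨ := (continuous_abs_rpow_sub_two_mul_self hp).measurable
  have hdil : ∀ r ∈ Ioo (0 : ℝ) 1,
      μ * (∫ x, |u x| ^ p ∂ν -
        p * ∫ x, |u x| ^ (p - 2) * u x * (u x - f ((1 - r) • x₀ + r • x)) ∂ν) ≤
      (r ^ k)⁻¹ * ∫ x, ‖fderiv ℝ f x‖ ^ p ∂ν := by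
    rintro r ⟨hr0, hr1⟩
    obtain ⟨K, F, hF, hFe⟩ := lipschitz_extension_dilation hopen hconv hbdd hf hx₀ hr0 hr1
    have hFB : ∀ᵐ x ∂ν, |F x| ≤ B := by
      filter_upwards [hΩ] with x hx
      rw [← hFe hx]
      exact hB _
    have h1 := hμ.le_of_lipschitzWith hp hμ0 hu hup hu0 hF hFB
    have h2 : ∫ x, |u x| ^ (p - 2) * u x * (u x - F x) ∂ν =
        ∫ x, |u x| ^ (p - 2) * u x * (u x - f ((1 - r) • x₀ + r • x)) ∂ν := by
      refine integral_congr_ae ?_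
      filter_upwards [hΩ] with x hx
      rw [← hFe hx]
    rw [h2] at h1
    refine h1.trans ?_
    have hgm : Measurable fun x => ‖fderiv ℝ f x‖ ^ p := (measurable_fderiv ℝ f).norm.pow_const p
    have h3 : ∀ᵐ x ∂ν, ‖fderiv ℝ F x‖ ^ p ≤ ‖fderiv ℝ f ((1 - r) • x₀ + r • x)‖ ^ p := by
      filter_upwards [hΩ] with x hx
      have : fderiv ℝ F x = r • fderiv ℝ f ((1 - r) • x₀ + r • x) := by
        rw [← (hFe.eventuallyEq_of_mem (hopen.mem_nhds hx)).fderiv_eq]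
        rw [fderiv_comp_smul (f := fun y => f ((1 - r) • x₀ + y)) r, fderiv_comp_add_left]
      rw [this, norm_smul, Real.norm_of_nonneg hr0.le]
      exact Real.rpow_le_rpow (by positivity)
        (mul_le_of_le_one_left (norm_nonneg _) hr1.le) hp0
    have h4 := h x₀ hx₀ r hr0 hr1.le _ hgm.ennreal_ofReal
    have hr : 0 ≤ (r ^ k)⁻¹ := by positivity
    rw [← ofReal_integral_eq_lintegral_ofReal hfE (ae_of_all _ fun x => by positivity),
      ← ENNReal.ofReal_mul hr] at h4
    have hintegr0 : 0 ≤ (r ^ k)⁻¹ * ∫ x, ‖fderiv ℝ f x‖ ^ p ∂ν :=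
      mul_nonneg hr (integral_nonneg fun x => by positivity)
    rw [integral_eq_lintegral_of_nonneg_ae (ae_of_all _ fun x => by positivity)
      ((measurable_fderiv ℝ F).norm.pow_const p).aestronglyMeasurable]
    refine ENNReal.toReal_le_of_le_ofReal hintegr0 (le_trans (lintegral_mono_ae ?_) h4)
    filter_upwards [h3] with x hx
    exact ENNReal.ofReal_le_ofReal hx
  have hup1 := integrable_abs_rpow_sub_one hp hu hup
  have hlim : Tendsto (fun r : ℝ => ∫ x, |u x| ^ (p - 2) * u x *
      (u x - f ((1 - r) • x₀ + r • x)) ∂ν) (𝓝[<] 1)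
      (𝓝 (∫ x, |u x| ^ (p - 2) * u x * (u x - f x) ∂ν)) := by
    refine tendsto_integral_filter_of_dominated_convergence
      (fun x => |u x| ^ p + |u x| ^ (p - 1) * B) ?_ ?_ (hup.add (hup1.mul_const B)) ?_
    · refine Eventually.of_forall fun r => Measurable.aestronglyMeasurable ?_
      exact (hΨ.comp hu).mul (hu.sub (hfm.comp (by fun_prop)))
    · refine Eventually.of_forall fun r => ae_of_all _ fun x => ?_
      rw [mul_sub, abs_rpow_sub_two_mul_self_mul_self hp]
      refine (norm_sub_le _ _).trans (add_le_add ?_ ?_)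
      · rw [Real.norm_of_nonneg (by positivity)]
      · rw [Real.norm_eq_abs, abs_mul, abs_abs_rpow_sub_two_mul_self hp]
        exact mul_le_mul_of_nonneg_left (hB _) (by positivity)
    · filter_upwards [hΩ] with x hx
      refine Tendsto.const_mul _ (tendsto_const_nhds.sub ?_)
      have hc : ContinuousAt f x := hf.continuousOn.continuousAt (hopen.mem_nhds hx)
      refine hc.tendsto.comp (tendsto_nhdsWithin_of_tendsto_nhds ?_)
      have : Continuous fun r : ℝ => (1 - r) • x₀ + r • x := by fun_prop
      simpa using this.tendsto 1
  have hlim2 : Tendsto (fun r : ℝ => (r ^ k)⁻¹ * ∫ x, ‖fderiv ℝ f x‖ ^ p ∂ν) (𝓝[<] 1)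
      (𝓝 (∫ x, ‖fderiv ℝ f x‖ ^ p ∂ν)) := by
    have h1 : Tendsto (fun r : ℝ => (r ^ k)⁻¹) (𝓝 1) (𝓝 ((1 ^ k)⁻¹)) :=
      ((continuous_pow k).tendsto 1).inv₀ (by simp)
    have h2 := (tendsto_nhdsWithin_of_tendsto_nhds (s := Iio 1) h1).mul_const
      (∫ x, ‖fderiv ℝ f x‖ ^ p ∂ν)
    simpa using h2
  refine le_of_tendsto_of_tendsto ((tendsto_const_nhds.sub (hlim.const_mul p)).const_mul μ)
    hlim2 ?_
  filter_upwards [Ioo_mem_nhdsLT (zero_lt_one' ℝ)] with r hr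
  exact hdil r hr

end Competitor

section Caccioppoli

variable {E : Type*} [NormedAddCommGroup E] [NormedSpace ℝ E] [MeasurableSpace E] [BorelSpace E]
  [FiniteDimensional ℝ E] {Ω : Set E} {ν : Measure E} [IsProbabilityMeasure ν] {p : ℝ} {k : ℕ}

theorem IsNeumannBound.setIntegral_norm_fderiv_rpow_le
    (hp : 1 < p) (hopen : IsOpen Ω) (hconv : Convex ℝ Ω) (hbdd : Bornology.IsBounded Ω)
    (hΩ : ∀ᵐ x ∂ν, x ∈ Ω) (h : HasDilationBound k Ω ν) {μ : ℝ} (hμ0 : 0 ≤ μ)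
    (hμ : IsNeumannBound p μ ν) {u : E → ℝ} (hu : Measurable u) (huL : LocallyLipschitzOn Ω u)
    (hup : Integrable (fun x => |u x| ^ p) ν) (hu0 : ∫ x, |u x| ^ (p - 2) * u x ∂ν = 0)
    (huE : Integrable (fun x => ‖fderiv ℝ u x‖ ^ p) ν)
    (hmin : ∫ x, ‖fderiv ℝ u x‖ ^ p ∂ν = μ * ∫ x, |u x| ^ p ∂ν) {t : ℝ} (ht : 0 < t) :
    ∫ x in {x | t < |u x|}, ‖fderiv ℝ u x‖ ^ p ∂ν ≤
      p * μ * ∫ x in {x | t < |u x|}, |u x| ^ p ∂ν := by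
  have hp0 : 0 < p := by linarith
  set f : E → ℝ := fun x => max (min (u x) t) (-t) with hf
  set S := {x | t < |u x|} with hS
  have hSm : MeasurableSet S := measurableSet_lt measurable_const hu.abs
  have hfm : Measurable f := (hu.min measurable_const).max measurable_const
  have hfd : ∀ᵐ x ∂ν, ‖fderiv ℝ f x‖ = if |u x| < t then ‖fderiv ℝ u x‖ else 0 := by
    filter_upwards [hΩ] with x hx
    exact norm_fderiv_clip (huL.continuousOn.continuousAt (hopen.mem_nhds hx)) ht
  have hle : ∀ᵐ x ∂ν, ‖fderiv ℝ f x‖ ^ p ≤ Sᶜ.indicator (fun x => ‖fderiv ℝ u x‖ ^ p) x := by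
    filter_upwards [hfd] with x hx
    rw [hx]
    split_ifs with hxt
    · rw [indicator_of_mem (show x ∈ Sᶜ from not_lt.2 hxt.le)]
    · rw [Real.zero_rpow hp0.ne']
      exact indicator_nonneg (fun _ _ => by positivity) _
  have hSE : Integrable (Sᶜ.indicator fun x => ‖fderiv ℝ u x‖ ^ p) ν := huE.indicator hSm.compl
  have hfE : Integrable (fun x => ‖fderiv ℝ f x‖ ^ p) ν := by
    refine hSE.mono' ((measurable_fderiv ℝ f).norm.pow_const p).aestronglyMeasurable ?_
    filter_upwards [hle] with x hx
    rwa [Real.norm_of_nonneg (by positivity)]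
  have hB : ∀ x, |f x| ≤ t := fun x => by
    rw [abs_le]
    exact ⟨le_max_right _ _, max_le (min_le_right _ _) (by linarith)⟩
  have h1 := hμ.le_of_locallyLipschitzOn hp hopen hconv hbdd hΩ h hμ0 hu hup hu0 hfm
    ((locallyLipschitz_clip t).comp_locallyLipschitzOn huL) hB hfE
  have h2 : ∫ x, ‖fderiv ℝ f x‖ ^ p ∂ν ≤ ∫ x in Sᶜ, ‖fderiv ℝ u x‖ ^ p ∂ν := by
    rw [← integral_indicator hSm.compl]
    exact integral_mono_ae hfE hSE hle
  have h3 := integral_add_compl hSm huE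
  have h4 : ∫ x, |u x| ^ (p - 2) * u x * (u x - f x) ∂ν ≤ ∫ x in S, |u x| ^ p ∂ν := by
    rw [← integral_indicator hSm]
    refine integral_mono_of_nonneg (ae_of_all _ fun x => ?_) (hup.indicator hSm)
      (ae_of_all _ fun x => ?_)
    · change 0 ≤ |u x| ^ (p - 2) * u x * (u x - f x)
      rw [mul_assoc]
      refine mul_nonneg (by positivity) ?_
      rcases le_total 0 (u x) with h | h
      · refine mul_nonneg h (sub_nonneg.2 (max_le (min_le_left _ _) (by linarith)))
      · refine mul_nonneg_of_nonpos_of_nonpos h (sub_nonpos.2 ?_)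
        exact le_trans (le_min le_rfl (by linarith)) (le_max_left _ _)
    · change |u x| ^ (p - 2) * u x * (u x - f x) ≤ S.indicator (fun x => |u x| ^ p) x
      by_cases hx : x ∈ S
      · rw [indicator_of_mem hx, mul_sub, abs_rpow_sub_two_mul_self_mul_self hp, mul_assoc]
        refine sub_le_self _ (mul_nonneg (by positivity) ?_)
        rcases le_total 0 (u x) with h | h
        · exact mul_nonneg h (le_trans (le_min h ht.le) (le_max_left _ _))
        · exact mul_nonneg_of_nonpos_of_nonpos h
            (max_le ((min_le_left _ _).trans h) (by linarith))
      · have hx' : |u x| ≤ t := not_lt.1 hx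
        rw [abs_le] at hx'
        have : f x = u x := by
          simp only [hf]
          rw [min_eq_left hx'.2, max_eq_left hx'.1]
        rw [indicator_of_notMem hx, this, sub_self, mul_zero]
  have h5 := mul_le_mul_of_nonneg_left h4 (mul_nonneg hp0.le hμ0)
  rw [mul_sub, ← hmin] at h1
  linarith

end Caccioppoli

section LevelSets

variable {E : Type*} [NormedAddCommGroup E] [NormedSpace ℝ E] [MeasurableSpace E] [BorelSpace E]
  [FiniteDimensional ℝ E] {Ω : Set E} {ν : Measure E} [IsProbabilityMeasure ν] {p D : ℝ} {k : ℕ}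

theorem ofReal_norm_rpow {F : Type*} [NormedAddCommGroup F] (hp : 0 ≤ p) (x : F) :
    ENNReal.ofReal (‖x‖ ^ p) = ‖x‖ₑ ^ p := by
  rw [← ENNReal.ofReal_rpow_of_nonneg (norm_nonneg x) hp, ofReal_norm]

/-- A Poincaré inequality, with an explicit constant, for functions of zero `p`-mean. -/
theorem HasDilationBound.integral_abs_rpow_le (hp : 1 < p) (hopen : IsOpen Ω)
    (hconv : Convex ℝ Ω) (hΩ : ∀ᵐ x ∂ν, x ∈ Ω) (hD : ∀ x ∈ Ω, ∀ y ∈ Ω, dist x y ≤ D)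
    {vol : Measure E} [vol.IsAddHaarMeasure] (hac : ν ≪ vol) (h : HasDilationBound k Ω ν)
    {u : E → ℝ} (hu : Measurable u) (huL : LocallyLipschitzOn Ω u)
    (hup : Integrable (fun x => |u x| ^ p) ν) (hu0 : ∫ x, |u x| ^ (p - 2) * u x ∂ν = 0)
    (huE : Integrable (fun x => ‖fderiv ℝ u x‖ ^ p) ν) :
    ∫ x, |u x| ^ p ∂ν ≤ 2 ^ k * D ^ p * ∫ x, ‖fderiv ℝ u x‖ ^ p ∂ν := by
  have hp0 : 0 < p := by linarith
  have hD0 : 0 ≤ D := by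
    obtain ⟨x, hx⟩ := hΩ.exists
    exact dist_nonneg.trans (hD x hx x hx)
  have hd : ∀ᵐ x ∂ν, DifferentiableAt ℝ u x := by
    filter_upwards [hΩ, hac.ae_le (huL.ae_differentiableAt hopen vol)] with x hx hx'
    exact hx' hx
  obtain ⟨g, hgm, hg, hge⟩ := huL.exists_isUpperGradientOn hconv hd
  have h1 := h.lintegral_lintegral_rpow_le hΩ hD hp hgm hg
  have hpE : ENNReal.ofReal p ≠ 0 := by simpa using hp0
  have hmem : MemLp u (ENNReal.ofReal p) ν := by
    rw [← integrable_norm_rpow_iff hu.aestronglyMeasurable hpE ENNReal.ofReal_ne_top]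
    simpa [ENNReal.toReal_ofReal hp0.le] using hup
  have hΨ := (continuous_abs_rpow_sub_two_mul_self hp).measurable
  have hΨu : Integrable (fun x => |u x| ^ (p - 2) * u x) ν := by
    refine (integrable_abs_rpow_sub_one hp hu hup).mono' (hΨ.comp hu).aestronglyMeasurable ?_
    exact Eventually.of_forall fun x => (abs_abs_rpow_sub_two_mul_self hp _).le
  have hpt : ∀ x, ENNReal.ofReal (∫ y, |u y| ^ p ∂ν) ≤
      ∫⁻ y, ENNReal.ofReal |u y - u x| ^ p ∂ν := by
    intro x
    have hintegr : Integrable (fun y => |u y - u x| ^ p) ν := by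
      have := (hmem.sub (memLp_const (u x))).integrable_norm_rpow hpE ENNReal.ofReal_ne_top
      simpa [ENNReal.toReal_ofReal hp0.le] using this
    simp_rw [ENNReal.ofReal_rpow_of_nonneg (abs_nonneg _) hp0.le]
    rw [← ofReal_integral_eq_lintegral_ofReal hintegr (ae_of_all _ fun y => by positivity)]
    refine ENNReal.ofReal_le_ofReal ?_
    have hsub : ∫ y, |u y| ^ p ∂ν =
        ∫ y, (|u y| ^ p - p * u x * (|u y| ^ (p - 2) * u y)) ∂ν := by
      rw [integral_sub hup (hΨu.const_mul _), integral_const_mul, hu0, mul_zero, sub_zero]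
    rw [hsub]
    refine integral_mono (hup.sub (hΨu.const_mul _)) hintegr fun y => ?_
    refine le_of_eq_of_le ?_ (abs_rpow_add_tangent_le hp (u y) (u y - u x))
    ring
  have h2 : ENNReal.ofReal (∫ y, |u y| ^ p ∂ν) ≤
      ∫⁻ x, ∫⁻ y, ENNReal.ofReal |u y - u x| ^ p ∂ν ∂ν := by
    refine le_trans ?_ (lintegral_mono hpt)
    simp
  have h3 : ∫⁻ x, g x ^ p ∂ν = ENNReal.ofReal (∫ x, ‖fderiv ℝ u x‖ ^ p ∂ν) := by
    rw [ofReal_integral_eq_lintegral_ofReal huE (ae_of_all _ fun y => by positivity)]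
    refine lintegral_congr_ae ?_
    filter_upwards [hge] with x hx
    rw [hx, ofReal_norm_rpow hp0.le]
  have h4 := h2.trans h1
  have hE0 : 0 ≤ ∫ x, ‖fderiv ℝ u x‖ ^ p ∂ν := integral_nonneg fun x => by positivity
  rw [h3, ENNReal.ofReal_rpow_of_nonneg hD0 hp0.le, ← ENNReal.ofReal_mul (by positivity),
    ← ENNReal.ofReal_mul (by positivity), ENNReal.ofReal_le_ofReal_iff (by positivity)] at h4
  linarith

/-- The isoperimetric-type inequality applied to the part of `F (|u|)` above the level `t`. -/
theorem HasDilationBound.lintegral_comp_max_abs_le (hk : 2 ≤ k) (hp : 1 < p) (hopen : IsOpen Ω)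
    (hconv : Convex ℝ Ω) (hΩ : ∀ᵐ x ∂ν, x ∈ Ω) (hD : ∀ x ∈ Ω, ∀ y ∈ Ω, dist x y ≤ D)
    {vol : Measure E} [vol.IsAddHaarMeasure] (hac : ν ≪ vol) (h : HasDilationBound k Ω ν)
    {u : E → ℝ} (hu : Measurable u) (huL : LocallyLipschitzOn Ω u) {t : ℝ} (ht : 0 < t)
    (ha0 : 0 < ν.real {x | t < |u x|}) (ha : ν.real {x | t < |u x|} ≤ 1 / 2)
    {F : ℝ → ℝ} (hF : ContDiff ℝ 1 F) :
    ∫⁻ x, ENNReal.ofReal |F (max |u x| t) - F t| ∂ν ≤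
      ENNReal.ofReal (2 ^ (k + 1) * D * ν.real {x | t < |u x|} ^ (1 / (k : ℝ))) *
        ((∫⁻ x in {x | t < |u x|}, ‖fderiv ℝ u x‖ₑ ^ p ∂ν) ^ (1 / p) *
          (∫⁻ x in {x | t < |u x|}, ‖deriv F |u x|‖ₑ ^ p.conjExponent ∂ν) ^
            (1 / p.conjExponent)) := by
  set S := {x | t < |u x|} with hS
  have hSm : MeasurableSet S := measurableSet_lt measurable_const hu.abs
  have hk0 : (k : ℝ) ≠ 0 := by positivity
  have hw : LocallyLipschitzOn Ω fun x => max |u x| t :=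
    (locallyLipschitz_max_abs t).comp_locallyLipschitzOn huL
  have hFt : ContDiff ℝ 1 fun s => F s - F t := hF.sub contDiff_const
  have hv : LocallyLipschitzOn Ω fun x => F (max |u x| t) - F t :=
    hFt.locallyLipschitz.comp_locallyLipschitzOn hw
  have hwd : ∀ᵐ x ∂ν, DifferentiableAt ℝ (fun x => max |u x| t) x := by
    filter_upwards [hΩ, hac.ae_le (hw.ae_differentiableAt hopen vol)] with x hx hx'
    exact hx' hx
  have hFd : ∀ᵐ x ∂ν, HasFDerivAt (fun x => F (max |u x| t) - F t)
      (deriv F (max |u x| t) • fderiv ℝ (fun x => max |u x| t) x) x := by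
    filter_upwards [hwd] with x hx
    have := (hF.differentiable one_ne_zero).differentiableAt (x := max |u x| t)
    exact (this.hasDerivAt.comp_hasFDerivAt x hx.hasFDerivAt).sub_const _
  obtain ⟨g, hgm, hg, hge⟩ := hv.exists_isUpperGradientOn hconv
    (hFd.mono fun x hx => hx.differentiableAt)
  have hvS : ∀ x ∉ S, F (max |u x| t) - F t = 0 := by
    intro x hx
    rw [max_eq_right (not_lt.1 hx), sub_self]
  have ha1 : ν.real S ≤ 1 := by linarith
  have hsk : (ν.real S ^ (1 / (k : ℝ))) ^ k = ν.real S := by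
    rw [← Real.rpow_natCast, ← Real.rpow_mul ha0.le, one_div_mul_cancel hk0, Real.rpow_one]
  have hνS : ν S = ENNReal.ofReal (ν.real S) := by rw [ofReal_measureReal]
  refine (h.lintegral_le_of_isUpperGradientOn hk hΩ hD hgm hg hSm hvS
    (Real.rpow_pos_of_pos ha0 (1 / (k : ℝ))) (Real.rpow_le_one ha0.le ha1 (by positivity))
    (by rw [hsk, hνS]) ?_).trans ?_
  · rw [hνS]
    refine (ENNReal.ofReal_le_ofReal ha).trans_eq ?_
    rw [ENNReal.ofReal_div_of_pos two_pos]
    simp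
  refine mul_le_mul_right ?_ _
  have hge' : ∀ᵐ x ∂ν, g x = S.indicator (fun x => ‖fderiv ℝ u x‖ₑ * ‖deriv F |u x|‖ₑ) x := by
    filter_upwards [hge, hFd, hΩ] with x h1 h2 h3
    have h4 := norm_fderiv_max_abs (huL.continuousOn.continuousAt (hopen.mem_nhds h3)) ht
    rw [h1, h2.fderiv, enorm_smul, mul_comm, ← ofReal_norm, h4]
    by_cases hx : x ∈ S
    · rw [indicator_of_mem hx, if_pos (show t < |u x| from hx), ofReal_norm,
        max_eq_left (le_of_lt hx)]
    · rw [indicator_of_notMem hx, if_neg (show ¬t < |u x| from hx)]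
      simp
  rw [lintegral_congr_ae hge', lintegral_indicator hSm]
  refine ENNReal.lintegral_mul_le_Lp_mul_Lq (ν.restrict S)
    (Real.HolderConjugate.conjExponent hp) ?_ ?_
  · exact (measurable_fderiv ℝ u).enorm.aemeasurable
  · exact ((measurable_deriv F).comp hu.abs).enorm.aemeasurable

end LevelSets

section LevelEstimates

variable {E : Type*} [NormedAddCommGroup E] [NormedSpace ℝ E] [MeasurableSpace E] [BorelSpace E]
  [FiniteDimensional ℝ E] {Ω : Set E} {ν : Measure E} [IsProbabilityMeasure ν] {p D : ℝ} {k : ℕ}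

theorem HasDilationBound.setIntegral_abs_rpow_sub_le (hk : 2 ≤ k) (hp : 1 < p) (hopen : IsOpen Ω)
    (hconv : Convex ℝ Ω) (hΩ : ∀ᵐ x ∂ν, x ∈ Ω) (hD : ∀ x ∈ Ω, ∀ y ∈ Ω, dist x y ≤ D)
    {vol : Measure E} [vol.IsAddHaarMeasure] (hac : ν ≪ vol) (h : HasDilationBound k Ω ν)
    {u : E → ℝ} (hu : Measurable u) (huL : LocallyLipschitzOn Ω u)
    (hup : Integrable (fun x => |u x| ^ p) ν)
    (huE : Integrable (fun x => ‖fderiv ℝ u x‖ ^ p) ν) {t : ℝ} (ht : 0 < t)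
    (ha0 : 0 < ν.real {x | t < |u x|}) (ha : ν.real {x | t < |u x|} ≤ 1 / 2) :
    ∫ x in {x | t < |u x|}, |u x| ^ p ∂ν - t ^ p * ν.real {x | t < |u x|} ≤
      2 ^ (k + 1) * D * ν.real {x | t < |u x|} ^ (1 / (k : ℝ)) *
        ((∫ x in {x | t < |u x|}, ‖fderiv ℝ u x‖ ^ p ∂ν) ^ (1 / p) *
          (p * (∫ x in {x | t < |u x|}, |u x| ^ p ∂ν) ^ (1 - 1 / p))) := by
  have hp0 : 0 < p := by linarith
  have hq := Real.HolderConjugate.conjExponent hp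
  have hq0 : 0 < p.conjExponent := hq.symm.pos
  have hq1 : 1 / p.conjExponent = 1 - 1 / p := by
    have := hq.inv_add_inv_eq_one
    rw [one_div, one_div]
    linarith
  have hD0 : 0 ≤ D := by
    obtain ⟨x, hx⟩ := hΩ.exists
    exact dist_nonneg.trans (hD x hx x hx)
  have h1 := h.lintegral_comp_max_abs_le hk hp hopen hconv hΩ hD hac hu huL ht ha0 ha
    (F := fun s => s ^ p) (Real.contDiff_rpow_const_of_le (by exact_mod_cast hp.le))
  set S := {x | t < |u x|} with hS
  have hSm : MeasurableSet S := measurableSet_lt measurable_const hu.abs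
  have hA0 : 0 ≤ ∫ x in S, ‖fderiv ℝ u x‖ ^ p ∂ν := integral_nonneg fun x => by positivity
  have hY0 : 0 ≤ ∫ x in S, |u x| ^ p ∂ν := integral_nonneg fun x => by positivity
  have hE : ∫⁻ x in S, ‖fderiv ℝ u x‖ₑ ^ p ∂ν =
      ENNReal.ofReal (∫ x in S, ‖fderiv ℝ u x‖ ^ p ∂ν) := by
    rw [ofReal_integral_eq_lintegral_ofReal huE.integrableOn
      (ae_of_all _ fun y => by positivity)]
    simp_rw [ofReal_norm_rpow hp0.le]
  have hder : ∀ x, ‖deriv (fun s : ℝ => s ^ p) |u x|‖ₑ ^ p.conjExponent =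
      ENNReal.ofReal p ^ p.conjExponent * ENNReal.ofReal (|u x| ^ p) := by
    intro x
    rw [Real.deriv_rpow_const, enorm_mul, ENNReal.mul_rpow_of_nonneg _ _ hq0.le,
      Real.enorm_of_nonneg hp0.le, Real.enorm_of_nonneg (by positivity),
      ENNReal.ofReal_rpow_of_nonneg (Real.rpow_nonneg (abs_nonneg _) _) hq0.le,
      ← Real.rpow_mul (abs_nonneg _)]
    congr 3
    rw [Real.conjExponent, mul_div_cancel₀ _ (by linarith)]
  have hY : ∫⁻ x in S, ‖deriv (fun s : ℝ => s ^ p) |u x|‖ₑ ^ p.conjExponent ∂ν =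
      ENNReal.ofReal p ^ p.conjExponent * ENNReal.ofReal (∫ x in S, |u x| ^ p ∂ν) := by
    simp_rw [hder]
    rw [lintegral_const_mul _ (hu.abs.pow_const p).ennreal_ofReal,
      ofReal_integral_eq_lintegral_ofReal hup.integrableOn (ae_of_all _ fun y => by positivity)]
  rw [hE, hY, ENNReal.mul_rpow_of_nonneg _ _ (by positivity), ← ENNReal.rpow_mul,
    mul_one_div_cancel hq0.ne', ENNReal.rpow_one, hq1,
    ENNReal.ofReal_rpow_of_nonneg hA0 (by positivity),
    ENNReal.ofReal_rpow_of_nonneg hY0 (by rw [← hq1]; positivity),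
    ← ENNReal.ofReal_mul hp0.le, ← ENNReal.ofReal_mul (by positivity),
    ← ENNReal.ofReal_mul (by positivity)] at h1
  have hL : ∫ x in S, |u x| ^ p ∂ν - t ^ p * ν.real S = ∫ x in S, (|u x| ^ p - t ^ p) ∂ν := by
    rw [integral_sub hup.integrableOn (integrable_const _), setIntegral_const, smul_eq_mul,
      mul_comm (ν.real S)]
  rw [hL]
  refine (ENNReal.ofReal_le_ofReal_iff (by positivity)).1 (le_trans ?_ h1)
  have hintegr : IntegrableOn (fun x => |u x| ^ p - t ^ p) S ν :=
    hup.integrableOn.sub (integrable_const _)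
  rw [ofReal_integral_eq_lintegral_ofReal hintegr]
  · refine le_trans ?_ (setLIntegral_le_lintegral S _)
    refine setLIntegral_mono' hSm fun x hx => ENNReal.ofReal_le_ofReal ?_
    rw [max_eq_left (le_of_lt hx)]
    exact le_abs_self _
  · filter_upwards [ae_restrict_mem hSm] with x hx
    exact sub_nonneg.2 (Real.rpow_le_rpow ht.le (le_of_lt hx) hp0.le)

theorem HasDilationBound.integral_max_abs_sub_le (hk : 2 ≤ k) (hp : 1 < p) (hopen : IsOpen Ω)
    (hconv : Convex ℝ Ω) (hΩ : ∀ᵐ x ∂ν, x ∈ Ω) (hD : ∀ x ∈ Ω, ∀ y ∈ Ω, dist x y ≤ D)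
    {vol : Measure E} [vol.IsAddHaarMeasure] (hac : ν ≪ vol) (h : HasDilationBound k Ω ν)
    {u : E → ℝ} (hu : Measurable u) (huL : LocallyLipschitzOn Ω u)
    (huE : Integrable (fun x => ‖fderiv ℝ u x‖ ^ p) ν) {t : ℝ} (ht : 0 < t)
    (ha0 : 0 < ν.real {x | t < |u x|}) (ha : ν.real {x | t < |u x|} ≤ 1 / 2) :
    ∫ x, max (|u x| - t) 0 ∂ν ≤
      2 ^ (k + 1) * D * ν.real {x | t < |u x|} ^ (1 / (k : ℝ)) *
        ((∫ x in {x | t < |u x|}, ‖fderiv ℝ u x‖ ^ p ∂ν) ^ (1 / p) *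
          ν.real {x | t < |u x|} ^ (1 - 1 / p)) := by
  have hp0 : 0 < p := by linarith
  have hq := Real.HolderConjugate.conjExponent hp
  have hq0 : 0 < p.conjExponent := hq.symm.pos
  have hq1 : 1 / p.conjExponent = 1 - 1 / p := by
    have := hq.inv_add_inv_eq_one
    rw [one_div, one_div]
    linarith
  have hD0 : 0 ≤ D := by
    obtain ⟨x, hx⟩ := hΩ.exists
    exact dist_nonneg.trans (hD x hx x hx)
  have h1 := h.lintegral_comp_max_abs_le hk hp hopen hconv hΩ hD hac hu huL ht ha0 ha
    (F := fun s => s) contDiff_fun_id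
  set S := {x | t < |u x|} with hS
  have hA0 : 0 ≤ ∫ x in S, ‖fderiv ℝ u x‖ ^ p ∂ν := integral_nonneg fun x => by positivity
  have hE : ∫⁻ x in S, ‖fderiv ℝ u x‖ₑ ^ p ∂ν =
      ENNReal.ofReal (∫ x in S, ‖fderiv ℝ u x‖ ^ p ∂ν) := by
    rw [ofReal_integral_eq_lintegral_ofReal huE.integrableOn
      (ae_of_all _ fun y => by positivity)]
    simp_rw [ofReal_norm_rpow hp0.le]
  have hY : ∫⁻ x in S, ‖deriv (fun s : ℝ => s) |u x|‖ₑ ^ p.conjExponent ∂ν =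
      ENNReal.ofReal (ν.real S) := by
    simp
  rw [hE, hY, hq1, ENNReal.ofReal_rpow_of_nonneg hA0 (by positivity),
    ENNReal.ofReal_rpow_of_nonneg ha0.le (by rw [← hq1]; positivity),
    ← ENNReal.ofReal_mul (by positivity), ← ENNReal.ofReal_mul (by positivity)] at h1
  rw [integral_eq_lintegral_of_nonneg_ae (f := fun x => max (|u x| - t) 0)
    (ae_of_all _ fun x => le_max_right _ _)
    ((hu.abs.sub_const t).max measurable_const).aestronglyMeasurable]
  refine ENNReal.toReal_le_of_le_ofReal (by positivity) (le_trans (lintegral_mono fun x => ?_) h1)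
  refine ENNReal.ofReal_le_ofReal (le_trans (le_of_eq ?_) (le_abs_self _))
  rw [← max_sub_sub_right, sub_self]

end LevelEstimates

section RealEstimates

variable {p : ℝ}

theorem two_mul_rpow_inv_le_four (hp : 1 < p) : (2 * p) ^ (1 / p) ≤ 4 := by
  have h := one_add_mul_self_le_rpow_one_add (by norm_num : (-1 : ℝ) ≤ 3) hp.le
  rw [one_div, Real.rpow_inv_le_iff_of_pos (by linarith) (by norm_num) (by linarith)]
  norm_num at h
  linarith

theorem rpow_inv_le_two (hp : 1 < p) : p ^ (1 / p) ≤ 2 := by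
  have h := one_add_mul_self_le_rpow_one_add (by norm_num : (-1 : ℝ) ≤ 1) hp.le
  rw [one_div, Real.rpow_inv_le_iff_of_pos (by linarith) (by norm_num) (by linarith)]
  norm_num at h
  linarith

theorem le_rpow_sub_one (hp : 1 < p) {z : ℝ} (hz : 3 ≤ z) : p ≤ z ^ (p - 1) := by
  have h1 := Real.add_one_le_exp (p - 1)
  have h2 : Real.exp 1 ≤ z := by linarith [Real.exp_one_lt_d9]
  have h3 := Real.rpow_le_rpow (Real.exp_pos 1).le h2 (by linarith : 0 ≤ p - 1)
  rw [Real.exp_one_rpow] at h3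
  linarith

theorem le_two_mul_of_sub_le_mul_rpow {Y A b c μ : ℝ} (hp : 1 < p) (hY : 0 < Y) (hA : 0 ≤ A)
    (hμ : 0 ≤ μ) (hc : 0 ≤ c) (hAY : A ≤ p * μ * Y)
    (hsub : Y - b ≤ c * (A ^ (1 / p) * (p * Y ^ (1 - 1 / p))))
    (hsmall : 4 * (c * μ ^ (1 / p)) * p ≤ 1) : Y ≤ 2 * b := by
  have hp0 : 0 < p := by linarith
  have h1 : A ^ (1 / p) ≤ 2 * μ ^ (1 / p) * Y ^ (1 / p) := by
    refine (Real.rpow_le_rpow hA hAY (by positivity)).trans ?_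
    rw [Real.mul_rpow (by positivity) hY.le, Real.mul_rpow hp0.le hμ]
    gcongr
    exact rpow_inv_le_two hp
  have h2 : Y ^ (1 / p) * Y ^ (1 - 1 / p) = Y := by
    rw [← Real.rpow_add hY]
    simp
  have h3 : c * (A ^ (1 / p) * (p * Y ^ (1 - 1 / p))) ≤
      c * (2 * μ ^ (1 / p) * Y ^ (1 / p) * (p * Y ^ (1 - 1 / p))) := by gcongr
  have h4 : c * (2 * μ ^ (1 / p) * Y ^ (1 / p) * (p * Y ^ (1 - 1 / p))) =
      2 * (c * μ ^ (1 / p)) * p * Y := by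
    nth_rewrite 3 [← h2]
    ring
  nlinarith

theorem mul_rpow_mul_rpow_le {A a c t μ : ℝ} (hp : 1 < p) (ha : 0 < a) (hA : 0 ≤ A) (hμ : 0 ≤ μ)
    (ht : 0 ≤ t) (hc : 0 ≤ c) (hAa : A ≤ p * μ * (2 * (t ^ p * a))) :
    c * (A ^ (1 / p) * a ^ (1 - 1 / p)) ≤ 4 * (c * μ ^ (1 / p)) * t * a := by
  have hp0 : 0 < p := by linarith
  have h1 : A ^ (1 / p) ≤ 4 * μ ^ (1 / p) * (t * a ^ (1 / p)) := by
    refine (Real.rpow_le_rpow hA hAa (by positivity)).trans ?_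
    rw [show p * μ * (2 * (t ^ p * a)) = 2 * p * μ * (t ^ p * a) by ring,
      Real.mul_rpow (by positivity) (by positivity), Real.mul_rpow (by positivity) hμ,
      Real.mul_rpow (by positivity) ha.le, ← Real.rpow_mul ht, mul_one_div_cancel hp0.ne',
      Real.rpow_one]
    gcongr
    exact two_mul_rpow_inv_le_four hp
  have h2 : a ^ (1 / p) * a ^ (1 - 1 / p) = a := by
    rw [← Real.rpow_add ha]
    simp
  calc c * (A ^ (1 / p) * a ^ (1 - 1 / p))
      ≤ c * (4 * μ ^ (1 / p) * (t * a ^ (1 / p)) * a ^ (1 - 1 / p)) := by gcongr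
    _ = 4 * (c * μ ^ (1 / p)) * t * (a ^ (1 / p) * a ^ (1 - 1 / p)) := by ring
    _ = _ := by rw [h2]

end RealEstimates

section Boundedness

variable {E : Type*} [NormedAddCommGroup E] [NormedSpace ℝ E] [MeasurableSpace E] [BorelSpace E]
  [FiniteDimensional ℝ E] {Ω : Set E} {ν : Measure E} [IsProbabilityMeasure ν] {p D : ℝ} {k : ℕ}

theorem HasDilationBound.ae_abs_le (hk : 2 ≤ k) (hp : 1 < p) (hopen : IsOpen Ω)
    (hconv : Convex ℝ Ω) (hbdd : Bornology.IsBounded Ω) (hΩ : ∀ᵐ x ∂ν, x ∈ Ω)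
    (hD : ∀ x ∈ Ω, ∀ y ∈ Ω, dist x y ≤ D)
    {vol : Measure E} [vol.IsAddHaarMeasure] (hac : ν ≪ vol) (h : HasDilationBound k Ω ν)
    {μ : ℝ} (hμ0 : 0 ≤ μ) (hμ : IsNeumannBound p μ ν)
    {u : E → ℝ} (hu : Measurable u) (huL : LocallyLipschitzOn Ω u)
    (hup : Integrable (fun x => |u x| ^ p) ν) (hu0 : ∫ x, |u x| ^ (p - 2) * u x ∂ν = 0)
    (huE : Integrable (fun x => ‖fderiv ℝ u x‖ ^ p) ν)
    (hmin : ∫ x, ‖fderiv ℝ u x‖ ^ p ∂ν = μ * ∫ x, |u x| ^ p ∂ν)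
    (hpos : 0 < ∫ x, |u x| ^ p ∂ν) :
    ∀ᵐ x ∂ν, |u x| ≤ (2 * (k + 1)) ^ (k + 1) * (4 * 2 ^ (k + 1) * (D * μ ^ (1 / p))) ^ k *
      (∫ x, |u x| ^ p ∂ν) ^ (1 / p) := by
  have hp0 : 0 < p := by linarith
  have hk0 : (k : ℝ) ≠ 0 := by positivity
  have hD0 : 0 ≤ D := by
    obtain ⟨x, hx⟩ := hΩ.exists
    exact dist_nonneg.trans (hD x hx x hx)
  set M := ∫ x, |u x| ^ p ∂ν with hM
  set n := M ^ (1 / p) with hn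
  have hn0 : 0 < n := Real.rpow_pos_of_pos hpos _
  have hnp : n ^ p = M := by
    rw [hn, ← Real.rpow_mul hpos.le, one_div_mul_cancel hp0.ne', Real.rpow_one]
  set q := D * μ ^ (1 / p) with hq
  have hq0 : 0 ≤ q := by positivity
  have hqp : q ^ p = D ^ p * μ := by
    rw [hq, Real.mul_rpow hD0 (by positivity), ← Real.rpow_mul hμ0, one_div_mul_cancel hp0.ne',
      Real.rpow_one]
  have hq1 : 1 ≤ 2 ^ k * q ^ p := by
    have := h.integral_abs_rpow_le hp hopen hconv hΩ hD hac hu huL hup hu0 huE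
    rw [hmin] at this
    rw [hqp]
    refine le_of_mul_le_mul_right ?_ hpos
    linarith
  have hq2 : 1 ≤ 2 ^ k * q := by
    rcases le_total q 1 with hq' | hq'
    · refine hq1.trans ?_
      gcongr
      simpa using Real.rpow_le_rpow_of_exponent_ge' hq0 hq' zero_le_one hp.le
    · exact one_le_mul_of_one_le_of_one_le (one_le_pow₀ one_le_two) hq'
  set Λ := 4 * 2 ^ (k + 1) * q with hΛ
  have hΛ8 : 8 ≤ Λ := by
    rw [hΛ, pow_succ]
    linarith
  have hΛ0 : 0 < Λ := by linarith
  set z := 2 * Λ with hz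
  set t₁ := z ^ k * n with ht₁
  have hz0 : 0 < z := by positivity
  have ht₁0 : 0 < t₁ := by positivity
  have hSm : ∀ t, MeasurableSet {x | t < |u x|} := fun t =>
    measurableSet_lt measurable_const hu.abs
  have hlevel : ∀ t, t₁ ≤ t → 0 < ν.real {x | t < |u x|} → ∫ x, max (|u x| - t) 0 ∂ν ≤
      Λ * t * (ν.real {x | t < |u x|} * ν.real {x | t < |u x|} ^ (1 / (k : ℝ))) := by
    intro t ht ha0
    have ht0 : 0 < t := ht₁0.trans_le ht
    set S := {x | t < |u x|} with hS
    set a := ν.real S with ha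
    set s := a ^ (1 / (k : ℝ)) with hs
    have hs0 : 0 < s := Real.rpow_pos_of_pos ha0 _
    have hsk : s ^ k = a := by
      rw [hs, ← Real.rpow_natCast, ← Real.rpow_mul ha0.le, one_div_mul_cancel hk0, Real.rpow_one]
    set Y := ∫ x in S, |u x| ^ p ∂ν with hY
    have hYa : t ^ p * a ≤ Y := by
      have : ∫ x in S, t ^ p ∂ν ≤ Y := by
        refine setIntegral_mono_on (integrable_const _).integrableOn hup.integrableOn (hSm t)
          fun x hx => ?_
        exact Real.rpow_le_rpow ht0.le (le_of_lt hx) hp0.le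
      rwa [setIntegral_const, smul_eq_mul, mul_comm] at this
    have hYM : Y ≤ M :=
      setIntegral_le_integral hup (ae_of_all _ fun x => Real.rpow_nonneg (abs_nonneg _) _)
    have hY0 : 0 < Y := lt_of_lt_of_le (by positivity) hYa
    have hsz : s * z ^ p ≤ 1 := by
      have h1 : (z ^ k) ^ p * a ≤ 1 := by
        have h2 : t₁ ^ p * a ≤ M := by
          refine le_trans ?_ (hYa.trans hYM)
          gcongr
        rw [ht₁, Real.mul_rpow (by positivity) hn0.le, hnp] at h2
        refine le_of_mul_le_mul_right ?_ hpos
        linarith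
      have h2 : (s * z ^ p) ^ k ≤ 1 := by
        rw [mul_pow, hsk, ← Real.rpow_mul_natCast hz0.le, mul_comm p,
          Real.rpow_natCast_mul hz0.le, mul_comm]
        exact h1
      exact (pow_le_one_iff_of_nonneg (by positivity) (by omega)).1 h2
    have hzp : p * z ≤ z ^ p := by
      have := le_rpow_sub_one hp (z := z) (by linarith)
      calc p * z ≤ z ^ (p - 1) * z := by gcongr
        _ = z ^ p := by rw [← Real.rpow_add_one hz0.ne']; ring_nf
    have hspz : s * (p * z) ≤ 1 := le_trans (by gcongr) hsz
    have hpz : 2 ≤ p * z := by nlinarith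
    have hs2 : s ≤ 1 / 2 := by linarith [mul_le_mul_of_nonneg_left hpz hs0.le]
    have ha2 : a ≤ 1 / 2 := by
      rw [← hsk]
      exact (pow_le_of_le_one hs0.le (by linarith) (by omega)).trans hs2
    have hA := hμ.setIntegral_norm_fderiv_rpow_le hp hopen hconv hbdd hΩ h hμ0 hu huL hup hu0
      huE hmin ht0
    have hA0 : 0 ≤ ∫ x in S, ‖fderiv ℝ u x‖ ^ p ∂ν := integral_nonneg fun x => by positivity
    have hY2 : Y ≤ 2 * (t ^ p * a) := by
      refine le_two_mul_of_sub_le_mul_rpow hp hY0 hA0 hμ0 (c := 2 ^ (k + 1) * D * s)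
        (by positivity) hA (h.setIntegral_abs_rpow_sub_le hk hp hopen hconv hΩ hD hac hu huL hup
          huE ht0 ha0 ha2) ?_
      have : 4 * (2 ^ (k + 1) * D * s * μ ^ (1 / p)) * p = s * (p * z) / 2 := by
        rw [hz, hΛ, hq]
        ring
      linarith
    refine (h.integral_max_abs_sub_le hk hp hopen hconv hΩ hD hac hu huL huE ht0 ha0 ha2).trans ?_
    refine (mul_rpow_mul_rpow_le hp ha0 hA0 hμ0 ht0.le (by positivity)
      (hA.trans (mul_le_mul_of_nonneg_left hY2 (by positivity)))).trans_eq ?_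
    rw [hΛ, hq]
    ring
  have hui : Integrable (fun x => |u x|) ν := by
    refine ((integrable_const (1 : ℝ)).add hup).mono' hu.abs.aestronglyMeasurable
      (ae_of_all _ fun x => ?_)
    rw [Real.norm_of_nonneg (abs_nonneg _), Pi.add_apply]
    rcases le_total |u x| 1 with hx | hx
    · have := Real.rpow_nonneg (abs_nonneg (u x)) p
      linarith
    · have := Real.rpow_le_rpow_of_exponent_le hx hp.le
      rw [Real.rpow_one] at this
      linarith
  have hexc : ∫ x, max (|u x| - t₁) 0 ∂ν ≤ n := by
    have hz1 : 1 ≤ z ^ k := one_le_pow₀ (by linarith)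
    have hnt : n ≤ t₁ := le_mul_of_one_le_left hn0.le hz1
    have h1 : ∫ x, n ^ (p - 1) * max (|u x| - t₁) 0 ∂ν ≤ M := by
      refine integral_mono_of_nonneg (ae_of_all _ fun x => ?_) hup (ae_of_all _ fun x => ?_)
      · exact mul_nonneg (by positivity) (le_max_right _ _)
      · change n ^ (p - 1) * max (|u x| - t₁) 0 ≤ |u x| ^ p
        rcases le_total |u x| t₁ with hx | hx
        · rw [max_eq_right (by linarith), mul_zero]
          positivity
        · have hux : 0 < |u x| := ht₁0.trans_le hx
          calc n ^ (p - 1) * max (|u x| - t₁) 0 ≤ |u x| ^ (p - 1) * |u x| := by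
                have h1 : n ^ (p - 1) ≤ |u x| ^ (p - 1) :=
                  Real.rpow_le_rpow hn0.le (hnt.trans hx) (by linarith)
                have h2 : max (|u x| - t₁) 0 ≤ |u x| := max_le (by linarith) hux.le
                exact mul_le_mul h1 h2 (le_max_right _ _) (by positivity)
            _ = |u x| ^ p := by rw [← Real.rpow_add_one hux.ne']; ring_nf
    rw [integral_const_mul] at h1
    have h2 : n ^ (p - 1) * n = M := by
      rw [← Real.rpow_add_one hn0.ne', ← hnp]
      ring_nf
    rw [← h2] at h1
    exact le_of_mul_le_mul_left h1 (by positivity)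
  set T' := (2 * ((k : ℝ) + 1)) ^ (k + 1) * Λ ^ k * n with hT'
  have hT'1 : 2 * t₁ ≤ T' := by
    have h1 : (2 : ℝ) ^ (k + 1) ≤ (2 * ((k : ℝ) + 1)) ^ (k + 1) := by
      gcongr
      have : (0 : ℝ) ≤ k := by positivity
      linarith
    calc 2 * t₁ = 2 ^ (k + 1) * Λ ^ k * n := by
          rw [ht₁, hz, mul_pow, pow_succ]
          ring
      _ ≤ (2 * ((k : ℝ) + 1)) ^ (k + 1) * Λ ^ k * n := by gcongr
  have hT : ∀ T, T' < T → ν.real {x | T < |u x|} = 0 := by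
    intro T hTT
    by_contra hne
    have hTpos : 0 < ν.real {x | T < |u x|} := lt_of_le_of_ne measureReal_nonneg (Ne.symm hne)
    have hT0 : 0 < T := by linarith
    have h1 := pow_le_mul_integral_of_excess_le hu.abs hui (by omega : 0 < k)
      (L := Λ * T) (by positivity) (t₀ := t₁) (T := T) (by linarith) hTpos (by
        intro t ht
        have hat : 0 < ν.real {x | t < |u x|} :=
          hTpos.trans_le (measureReal_mono fun x hx => lt_trans ht.2 hx)
        refine (hlevel t ht.1 hat).trans ?_
        have := ht.2.le
        gcongr)
    have h2 : (T / (2 * ((k : ℝ) + 1))) ^ (k + 1) ≤ (Λ * T) ^ k * n := by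
      refine le_trans ?_ (h1.trans (mul_le_mul_of_nonneg_left hexc (by positivity)))
      refine pow_le_pow_left₀ (by positivity) ?_ _
      rw [← div_div]
      gcongr
      linarith
    rw [div_pow, div_le_iff₀ (by positivity), mul_pow, pow_succ T] at h2
    have h3 : T ^ k * T ≤ T ^ k * T' := by
      rw [hT']
      linarith
    exact absurd (le_of_mul_le_mul_left h3 (by positivity)) (not_le.2 hTT)
  have hall : ∀ᵐ x ∂ν, ∀ j : ℕ, |u x| ≤ T' + 1 / ((j : ℝ) + 1) := by
    refine ae_all_iff.2 fun j => ?_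
    have := hT (T' + 1 / ((j : ℝ) + 1)) (lt_add_of_pos_right _ (by positivity))
    rw [measureReal_eq_zero_iff] at this
    rw [ae_iff]
    simpa only [not_le] using this
  filter_upwards [hall] with x hx
  have hlim : Tendsto (fun j : ℕ => T' + 1 / ((j : ℝ) + 1)) atTop (𝓝 (T' + 0)) :=
    tendsto_const_nhds.add tendsto_one_div_add_atTop_nhds_zero_nat
  rw [add_zero] at hlim
  exact ge_of_tendsto' hlim hx

end Boundedness

section Constants

theorem volume_ball_toReal_le_two_pow {k : ℕ} (hk : 2 ≤ k) :
    (volume (Metric.ball (0 : EuclideanSpace ℝ (Fin k)) 1)).toReal ≤ 2 ^ k := by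
  have : Nonempty (Fin k) := ⟨⟨0, by omega⟩⟩
  rw [EuclideanSpace.volume_ball, ENNReal.ofReal_one, one_pow, one_mul, Fintype.card_fin,
    ENNReal.toReal_ofReal (by positivity)]
  have hk2 : (2 : ℝ) ≤ (k : ℝ) / 2 + 1 := by
    have : (2 : ℝ) ≤ k := by exact_mod_cast hk
    linarith
  have hG : 1 ≤ Real.Gamma ((k : ℝ) / 2 + 1) := by
    have := Real.Gamma_strictMonoOn_Ici.monotoneOn self_mem_Ici hk2 hk2
    rwa [Real.Gamma_two] at this
  refine (div_le_self (by positivity) hG).trans (pow_le_pow_left₀ (by positivity) ?_ k)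
  rw [Real.sqrt_le_left (by norm_num)]
  linarith [Real.pi_lt_four]

theorem two_mul_succ_pow_mul_two_pow_le {k : ℕ} (hk : 3 ≤ k) :
    2 * ((k : ℝ) + 1) ^ (k + 1) * 2 ^ (k * k) ≤ (k : ℝ) ^ (k * (k + 1)) := by
  rcases hk.eq_or_lt with rfl | hk
  · norm_num
  have h1 : (k : ℝ) + 1 ≤ 2 ^ k := by exact_mod_cast Nat.lt_two_pow_self (n := k)
  have h4 : (4 : ℝ) ≤ k := by exact_mod_cast hk
  calc 2 * ((k : ℝ) + 1) ^ (k + 1) * 2 ^ (k * k)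
      ≤ 2 * (2 ^ k) ^ (k + 1) * 2 ^ (k * k) := by gcongr
    _ = 2 ^ (1 + k * (k + 1) + k * k) := by rw [← pow_mul, pow_add, pow_add, pow_one]
    _ ≤ 2 ^ (2 * (k * (k + 1))) := by
        refine pow_le_pow_right₀ one_le_two ?_
        nlinarith
    _ = 4 ^ (k * (k + 1)) := by
        rw [pow_mul]
        norm_num
    _ ≤ _ := by gcongr

theorem two_pow_le_div_pow {k : ℕ} (hk : 2 ≤ k) :
    (2 : ℝ) ^ k ≤ ((k : ℝ) / ((k : ℝ) - 1)) ^ (k * (k - 1)) := by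
  obtain ⟨j, rfl⟩ : ∃ j, k = j + 1 := ⟨k - 1, by omega⟩
  have hj : (0 : ℝ) < j := by exact_mod_cast (by omega : 0 < j)
  have h1 := one_add_mul_le_pow (a := 1 / (j : ℝ)) (by
    have : (0 : ℝ) < 1 / j := by positivity
    linarith) j
  rw [mul_one_div_cancel hj.ne'] at h1
  have h2 : ((j + 1 : ℕ) : ℝ) / (((j + 1 : ℕ) : ℝ) - 1) = 1 + 1 / (j : ℝ) := by
    rw [Nat.cast_succ, add_sub_cancel_right, add_div, div_self hj.ne']
  rw [h2, Nat.add_sub_cancel, mul_comm, pow_mul]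
  refine pow_le_pow_left₀ (by norm_num) ?_ _
  linarith

theorem explicit_constant_le_Kinf {k : ℕ} (hk : 3 ≤ k) :
    (2 * ((k : ℝ) + 1)) ^ (k + 1) * (4 * 2 ^ (k + 1)) ^ k ≤ Kinf k := by
  have hω := volume_ball_toReal_le_two_pow (by omega : 2 ≤ k)
  have hω0 : 0 < (volume (Metric.ball (0 : EuclideanSpace ℝ (Fin k)) 1)).toReal :=
    ENNReal.toReal_pos (Metric.measure_ball_pos _ _ one_pos).ne' measure_ball_lt_top.ne
  have hω' := inv_anti₀ hω0 hω
  have h1 := two_pow_le_div_pow (by omega : 2 ≤ k)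
  have h2 : (4 * (k : ℝ) ^ (k + 1)) ^ k ≤ (1 + 4 * (k : ℝ) ^ (k + 1)) ^ k := by
    gcongr
    linarith
  have h3 := two_mul_succ_pow_mul_two_pow_le hk
  calc (2 * ((k : ℝ) + 1)) ^ (k + 1) * (4 * 2 ^ (k + 1)) ^ k
      = 16 ^ k * (2 * ((k : ℝ) + 1) ^ (k + 1) * 2 ^ (k * k)) := by
        rw [show (16 : ℝ) = 2 * 2 * 4 by norm_num, pow_succ 2 k]
        simp only [mul_pow, ← pow_mul, pow_succ]
        ring
    _ ≤ 16 ^ k * (k : ℝ) ^ (k * (k + 1)) := by gcongr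
    _ = 2 ^ (2 * k) * (2 ^ k)⁻¹ * (4 * (k : ℝ) ^ (k + 1)) ^ k * 2 ^ k := by
        rw [mul_right_comm _ _ ((2 : ℝ) ^ k), inv_mul_cancel_right₀ (by positivity), pow_mul 2 2 k,
          mul_pow, ← pow_mul (k : ℝ), mul_comm (k + 1) k, ← mul_assoc, ← mul_pow]
        norm_num
    _ ≤ Kinf k := by
        rw [Kinf]
        gcongr

end Constants

section Weight

theorem lintegral_comp_add_smul {E : Type*} [NormedAddCommGroup E] [NormedSpace ℝ E]
    [FiniteDimensional ℝ E] [MeasurableSpace E] [BorelSpace E] (vol : Measure E)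
    [vol.IsAddHaarMeasure] (G : E → ℝ≥0∞) (c : E) {t : ℝ} (ht : 0 < t) :
    ∫⁻ y, G (c + t • y) ∂vol =
      ENNReal.ofReal (t ^ Module.finrank ℝ E)⁻¹ * ∫⁻ y, G y ∂vol := by
  have h1 := (Homeomorph.smulOfNeZero t ht.ne' : E ≃ₜ E).measurableEmbedding.lintegral_map
    (μ := vol) fun z => G (c + z)
  have h2 : Measure.map (Homeomorph.smulOfNeZero t ht.ne' : E ≃ₜ E) vol =
      ENNReal.ofReal |(t ^ Module.finrank ℝ E)⁻¹| • vol := Measure.map_addHaar_smul vol ht.ne'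
  rw [h2, lintegral_smul_measure, lintegral_add_left_eq_self, abs_of_pos (by positivity)] at h1
  exact h1.symm

variable {N m : ℕ} {Ω : Set (EuclideanSpace ℝ (Fin N))} {φ : EuclideanSpace ℝ (Fin N) → ℝ}

/-- The probability measure on `Ω` whose density is proportional to the weight `φ`. -/
noncomputable def weightMeasure (Ω : Set (EuclideanSpace ℝ (Fin N)))
    (φ : EuclideanSpace ℝ (Fin N) → ℝ) : Measure (EuclideanSpace ℝ (Fin N)) :=
  (volume.restrict Ω).withDensity fun x => ENNReal.ofReal (φ x / ∫ y in Ω, φ y)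

theorem aemeasurable_weight_density (hφint : IntegrableOn φ Ω volume) :
    AEMeasurable (fun x => ENNReal.ofReal (φ x / ∫ y in Ω, φ y)) (volume.restrict Ω) :=
  (hφint.aestronglyMeasurable.aemeasurable.div_const _).ennreal_ofReal

theorem setIntegral_weight_pos (hopen : IsOpen Ω) (hne : Ω.Nonempty)
    (hφint : IntegrableOn φ Ω volume) (hφ : ∀ x ∈ Ω, 0 < φ x) : 0 < ∫ y in Ω, φ y := by
  rw [setIntegral_pos_iff_support_of_nonneg_ae
    (ae_restrict_of_forall_mem hopen.measurableSet fun x hx => (hφ x hx).le) hφint,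
    inter_eq_right.2 (show Ω ⊆ Function.support φ from fun x hx => (hφ x hx).ne')]
  exact hopen.measure_pos volume hne

theorem ae_weightMeasure_iff (hopen : IsOpen Ω) (hne : Ω.Nonempty)
    (hφint : IntegrableOn φ Ω volume) (hφ : ∀ x ∈ Ω, 0 < φ x)
    {P : EuclideanSpace ℝ (Fin N) → Prop} :
    (∀ᵐ x ∂weightMeasure Ω φ, P x) ↔ ∀ᵐ x ∂volume.restrict Ω, P x := by
  have hΦ := setIntegral_weight_pos hopen hne hφint hφ
  rw [weightMeasure, ae_withDensity_iff' (aemeasurable_weight_density hφint),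
    ae_restrict_iff' hopen.measurableSet, ae_restrict_iff' hopen.measurableSet]
  refine eventually_congr (Eventually.of_forall fun x => ?_)
  refine forall_congr' fun hx => ?_
  have : ENNReal.ofReal (φ x / ∫ y in Ω, φ y) ≠ 0 :=
    (ENNReal.ofReal_pos.2 (div_pos (hφ x hx) hΦ)).ne'
  simp [this]

theorem toReal_weight_density_smul_ae_eq (hopen : IsOpen Ω) (hne : Ω.Nonempty)
    (hφint : IntegrableOn φ Ω volume) (hφ : ∀ x ∈ Ω, 0 < φ x)
    (F : EuclideanSpace ℝ (Fin N) → ℝ) :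
    (fun x => (ENNReal.ofReal (φ x / ∫ y in Ω, φ y)).toReal • F x) =ᵐ[volume.restrict Ω]
      fun x => (∫ y in Ω, φ y)⁻¹ * (φ x * F x) := by
  have hΦ := setIntegral_weight_pos hopen hne hφint hφ
  refine ae_restrict_of_forall_mem hopen.measurableSet fun x hx => ?_
  simp only [smul_eq_mul]
  rw [ENNReal.toReal_ofReal (div_pos (hφ x hx) hΦ).le]
  ring

theorem integral_weightMeasure (hopen : IsOpen Ω) (hne : Ω.Nonempty)
    (hφint : IntegrableOn φ Ω volume) (hφ : ∀ x ∈ Ω, 0 < φ x)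
    (F : EuclideanSpace ℝ (Fin N) → ℝ) :
    ∫ x, F x ∂weightMeasure Ω φ = (∫ y in Ω, φ y)⁻¹ * ∫ x in Ω, φ x * F x := by
  rw [weightMeasure, integral_withDensity_eq_integral_toReal_smul₀
    (aemeasurable_weight_density hφint) (Eventually.of_forall fun _ => ENNReal.ofReal_lt_top),
    integral_congr_ae (toReal_weight_density_smul_ae_eq hopen hne hφint hφ F),
    integral_const_mul]

theorem IntegrableOn.integrable_weightMeasure (hopen : IsOpen Ω) (hne : Ω.Nonempty)
    (hφint : IntegrableOn φ Ω volume) (hφ : ∀ x ∈ Ω, 0 < φ x)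
    {F : EuclideanSpace ℝ (Fin N) → ℝ} (hF : IntegrableOn (fun x => φ x * F x) Ω volume) :
    Integrable F (weightMeasure Ω φ) := by
  rw [weightMeasure, integrable_withDensity_iff_integrable_smul₀'
    (aemeasurable_weight_density hφint) (Eventually.of_forall fun _ => ENNReal.ofReal_lt_top),
    integrable_congr (toReal_weight_density_smul_ae_eq hopen hne hφint hφ F)]
  exact hF.const_mul _

theorem isProbabilityMeasure_weightMeasure (hopen : IsOpen Ω) (hne : Ω.Nonempty)
    (hφint : IntegrableOn φ Ω volume) (hφ : ∀ x ∈ Ω, 0 < φ x) :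
    IsProbabilityMeasure (weightMeasure Ω φ) := by
  have hΦ := setIntegral_weight_pos hopen hne hφint hφ
  constructor
  rw [weightMeasure, withDensity_apply _ MeasurableSet.univ, Measure.restrict_univ,
    ← ofReal_integral_eq_lintegral_ofReal (hφint.div_const _)
      (ae_restrict_of_forall_mem hopen.measurableSet fun x hx => (div_pos (hφ x hx) hΦ).le),
    integral_div, div_self hΦ.ne', ENNReal.ofReal_one]

theorem IsAlphaConcaveOn.pow_mul_le (hm : 0 < m) (hφ : IsAlphaConcaveOn (1 / m) Ω φ)
    {x y : EuclideanSpace ℝ (Fin N)} (hx : x ∈ Ω) (hy : y ∈ Ω) {t : ℝ} (ht0 : 0 < t)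
    (ht1 : t ≤ 1) : t ^ m * φ y ≤ φ ((1 - t) • x + t • y) := by
  have hz : (1 - t) • x + t • y ∈ Ω := hφ.2.1 hx hy (by linarith) ht0.le (by ring)
  have hroot : ∀ z ∈ Ω, (φ z ^ (1 / (m : ℝ))) ^ m = φ z := fun z hz => by
    rw [one_div, Real.rpow_inv_natCast_pow (hφ.1 z hz).le hm.ne']
  have h := hφ.2.2 hx hy (by linarith : 0 ≤ 1 - t) ht0.le (by ring)
  simp only [smul_eq_mul] at h
  have hx0 : 0 ≤ φ x ^ (1 / (m : ℝ)) := Real.rpow_nonneg (hφ.1 x hx).le _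
  have hy0 : 0 ≤ φ y ^ (1 / (m : ℝ)) := Real.rpow_nonneg (hφ.1 y hy).le _
  have h' : t * φ y ^ (1 / (m : ℝ)) ≤ φ ((1 - t) • x + t • y) ^ (1 / (m : ℝ)) := by
    have := mul_nonneg (by linarith : 0 ≤ 1 - t) hx0
    linarith
  have h'' := pow_le_pow_left₀ (by positivity) h' m
  rwa [mul_pow, hroot y hy, hroot _ hz] at h''

theorem IsAlphaConcaveOn.hasDilationBound (hm : 0 < m) (hopen : IsOpen Ω) (hne : Ω.Nonempty)
    (hφint : IntegrableOn φ Ω volume) (hφ : IsAlphaConcaveOn (1 / m) Ω φ) :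
    HasDilationBound (N + m) Ω (weightMeasure Ω φ) := by
  intro x hx t ht0 ht1 h hh
  have hΦ := setIntegral_weight_pos hopen hne hφint hφ.1
  have hd := aemeasurable_weight_density hφint
  have hT : Measurable fun y => h ((1 - t) • x + t • y) := by fun_prop
  rw [weightMeasure, lintegral_withDensity_eq_lintegral_mul₀ hd hT.aemeasurable,
    lintegral_withDensity_eq_lintegral_mul₀ hd hh.aemeasurable]
  set w : EuclideanSpace ℝ (Fin N) → ℝ≥0∞ := fun y => ENNReal.ofReal (φ y / ∫ z in Ω, φ z)
    with hw
  set G : EuclideanSpace ℝ (Fin N) → ℝ≥0∞ := Ω.indicator (w * h) with hG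
  have hpt : ∀ y ∈ Ω, (w * fun y => h ((1 - t) • x + t • y)) y ≤
      ENNReal.ofReal (t ^ m)⁻¹ * G ((1 - t) • x + t • y) := by
    intro y hy
    have hz : (1 - t) • x + t • y ∈ Ω := hφ.2.1 hx hy (by linarith) ht0.le (by ring)
    rw [hG, indicator_of_mem hz, Pi.mul_apply, Pi.mul_apply, ← mul_assoc]
    gcongr
    rw [hw]
    simp only
    rw [← ENNReal.ofReal_mul (by positivity)]
    refine ENNReal.ofReal_le_ofReal ?_
    rw [← mul_div_assoc, inv_mul_eq_div]
    gcongr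
    rw [le_div_iff₀ (by positivity), mul_comm]
    exact hφ.pow_mul_le hm hx hy ht0 ht1
  calc ∫⁻ y in Ω, (w * fun y => h ((1 - t) • x + t • y)) y
      ≤ ∫⁻ y in Ω, ENNReal.ofReal (t ^ m)⁻¹ * G ((1 - t) • x + t • y) :=
        setLIntegral_mono' hopen.measurableSet hpt
    _ ≤ ∫⁻ y, ENNReal.ofReal (t ^ m)⁻¹ * G ((1 - t) • x + t • y) := setLIntegral_le_lintegral _ _
    _ = ENNReal.ofReal (t ^ m)⁻¹ * (ENNReal.ofReal (t ^ N)⁻¹ * ∫⁻ y, G y) := by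
        rw [lintegral_const_mul' _ _ ENNReal.ofReal_ne_top,
          lintegral_comp_add_smul volume G _ ht0, finrank_euclideanSpace_fin]
    _ = ENNReal.ofReal (t ^ (N + m))⁻¹ * ∫⁻ y in Ω, (w * h) y := by
        rw [hG, lintegral_indicator hopen.measurableSet, ← mul_assoc,
          ← ENNReal.ofReal_mul (by positivity), pow_add, mul_inv, mul_comm (t ^ m)⁻¹]

theorem setIntegral_weight_mul_nonneg (hopen : IsOpen Ω) (hφ : ∀ x ∈ Ω, 0 < φ x)
    {F : EuclideanSpace ℝ (Fin N) → ℝ} (hF : ∀ x, 0 ≤ F x) : 0 ≤ ∫ x in Ω, φ x * F x :=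
  setIntegral_nonneg hopen.measurableSet fun x hx => mul_nonneg (hφ x hx).le (hF x)

theorem weighted_rayleigh_quotient_nonneg (hopen : IsOpen Ω) (hφ : ∀ x ∈ Ω, 0 < φ x) (p : ℝ)
    (f : EuclideanSpace ℝ (Fin N) → ℝ) :
    0 ≤ (∫ x in Ω, φ x * ‖fderiv ℝ f x‖ ^ p) / (∫ x in Ω, φ x * |f x| ^ p) :=
  div_nonneg (setIntegral_weight_mul_nonneg hopen hφ fun x => by positivity)
    (setIntegral_weight_mul_nonneg hopen hφ fun x => by positivity)

theorem muP_nonneg (hopen : IsOpen Ω) (hφ : ∀ x ∈ Ω, 0 < φ x) (p : ℝ) : 0 ≤ muP p Ω φ := by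
  refine Real.sInf_nonneg ?_
  rintro r ⟨f, K, -, -, -, rfl⟩
  exact weighted_rayleigh_quotient_nonneg hopen hφ p f

theorem isNeumannBound_muP (hopen : IsOpen Ω) (hne : Ω.Nonempty)
    (hφint : IntegrableOn φ Ω volume) (hφ : ∀ x ∈ Ω, 0 < φ x) {p : ℝ} (hp : 1 < p) :
    IsNeumannBound p (muP p Ω φ) (weightMeasure Ω φ) := by
  intro f K hf hf0
  have hΦ := setIntegral_weight_pos hopen hne hφint hφ
  rw [integral_weightMeasure hopen hne hφint hφ] at hf0 ⊢
  rw [integral_weightMeasure hopen hne hφint hφ, mul_left_comm]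
  refine mul_le_mul_of_nonneg_left ?_ (by positivity)
  have hI : 0 ≤ ∫ x in Ω, φ x * |f x| ^ p :=
    setIntegral_weight_mul_nonneg hopen hφ fun x => by positivity
  rcases hI.eq_or_lt with hI0 | hIpos
  · rw [← hI0, mul_zero]
    exact setIntegral_weight_mul_nonneg hopen hφ fun x => by positivity
  rw [← le_div_iff₀ hIpos]
  refine csInf_le ⟨0, ?_⟩ ⟨f, K, hf, fun hzero => hIpos.ne' ?_, ?_, rfl⟩
  · rintro r ⟨g, L, -, -, -, rfl⟩
    exact weighted_rayleigh_quotient_nonneg hopen hφ p g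
  · refine integral_eq_zero_of_ae ?_
    filter_upwards [hzero] with x hx
    simp [hx, Real.zero_rpow (by linarith : p ≠ 0)]
  · rcases mul_eq_zero.1 hf0 with h | h
    · exact absurd h (inv_pos.2 hΦ).ne'
    · simpa only [mul_assoc] using h

end Weight

/-- Corollary 3.4: sharp `L^∞` bound for first eigenfunctions of the
weighted Neumann `p`-Laplacian.  If `φ` is positive and `(1/m)`-concave on the open bounded
convex set `Ω ⊂ ℝ^N` and `ū` is a first eigenfunction for `μ_p(Ω,φ)`, then
`‖ū‖_{L^∞(Ω)} ≤ K_∞(N+m) μ_p(Ω,φ)^{(N+m)/p} D_Ω^{N+m} (∫_Ω φ)^{-1/p} ‖ū‖_{L^p(Ω,φ)}`. -/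
theorem stmt7 (p : ℝ) (hp : 1 < p) (N m : ℕ) (hN : 2 ≤ N) (hm : 0 < m)
    (Ω : Set (EuclideanSpace ℝ (Fin N)))
    (hopen : IsOpen Ω) (hconv : Convex ℝ Ω) (hbdd : Bornology.IsBounded Ω) (hne : Ω.Nonempty)
    (φ : EuclideanSpace ℝ (Fin N) → ℝ)
    (hφint : IntegrableOn φ Ω volume)
    (hφ : IsAlphaConcaveOn (1 / m) Ω φ)
    (u : EuclideanSpace ℝ (Fin N) → ℝ)
    (hu : IsFirstEigenfunction p Ω φ u) :
    ∀ᵐ x ∂(volume.restrict Ω),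
      |u x| ≤ Kinf (N + m) * muP p Ω φ ^ (((N : ℝ) + m) / p) *
        Metric.diam Ω ^ (N + m : ℕ) * (∫ y in Ω, φ y) ^ (-(1 : ℝ) / p) *
        (∫ y in Ω, φ y * |u y| ^ p) ^ ((1 : ℝ) / p) := by
  obtain ⟨huL, hu_ne, hup, huE, hu0, hmin⟩ := hu
  have hpos := hφ.1
  have hΦ := setIntegral_weight_pos hopen hne hφint hpos
  have := isProbabilityMeasure_weightMeasure hopen hne hφint hpos
  set v : EuclideanSpace ℝ (Fin N) → ℝ := Ω.indicator u with hv
  have hvu : EqOn v u Ω := fun x hx => indicator_of_mem hx u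
  have hvd : ∀ x ∈ Ω, fderiv ℝ v x = fderiv ℝ u x := fun x hx =>
    Filter.EventuallyEq.fderiv_eq (hvu.eventuallyEq_of_mem (hopen.mem_nhds hx))
  have huc : ContinuousOn u Ω := LocallyLipschitzOn.continuousOn fun x hx => huL x hx
  have hvm : Measurable v := by
    classical
    rw [hv, ← piecewise_eq_indicator]
    exact huc.measurable_piecewise continuousOn_const hopen.measurableSet
  have hvL : LocallyLipschitzOn Ω v := by
    intro x hx
    obtain ⟨K, t, ht, hK⟩ := huL x hx
    refine ⟨K, t ∩ Ω, inter_mem ht self_mem_nhdsWithin, fun y hy z hz => ?_⟩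
    rw [hvu hy.2, hvu hz.2]
    exact hK hy.1 hz.1
  have hswap : ∀ {F G : EuclideanSpace ℝ (Fin N) → ℝ}, EqOn F G Ω →
      ∫ x in Ω, φ x * F x = ∫ x in Ω, φ x * G x := fun h =>
    setIntegral_congr_fun hopen.measurableSet fun x hx => by simp only [h hx]
  have hvp : ∫ x in Ω, φ x * |v x| ^ p = ∫ x in Ω, φ x * |u x| ^ p :=
    hswap fun x hx => by simp only [hvu hx]
  have hvE : ∫ x in Ω, φ x * ‖fderiv ℝ v x‖ ^ p = ∫ x in Ω, φ x * ‖fderiv ℝ u x‖ ^ p :=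
    hswap fun x hx => by simp only [hvd x hx]
  have hIpos : 0 < ∫ x in Ω, φ x * |u x| ^ p := by
    refine (setIntegral_weight_mul_nonneg hopen hpos fun x => by positivity).lt_of_ne'
      fun h0 => hu_ne ?_
    rw [setIntegral_eq_zero_iff_of_nonneg_ae
      (ae_restrict_of_forall_mem hopen.measurableSet fun x hx =>
        mul_nonneg (hpos x hx).le (by positivity)) hup] at h0
    filter_upwards [h0, ae_restrict_mem hopen.measurableSet] with x hx hxΩ
    have h1 := (mul_eq_zero.1 hx).resolve_left (hpos x hxΩ).ne'
    exact abs_eq_zero.1 ((Real.rpow_eq_zero (abs_nonneg _) (by linarith)).1 h1)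
  have key := (hφ.hasDilationBound hm hopen hne hφint).ae_abs_le (vol := volume)
    (by omega : 2 ≤ N + m) hp hopen hconv hbdd
    ((ae_weightMeasure_iff hopen hne hφint hpos).2 (ae_restrict_mem hopen.measurableSet))
    (fun x hx y hy => Metric.dist_le_diam_of_mem hbdd hx hy)
    ((withDensity_absolutelyContinuous _ _).trans Measure.restrict_le_self.absolutelyContinuous)
    (muP_nonneg hopen hpos p) (isNeumannBound_muP hopen hne hφint hpos hp) hvm hvL
    (IntegrableOn.integrable_weightMeasure hopen hne hφint hpos <|
      hup.congr_fun (fun x hx => by simp only [hvu hx]) hopen.measurableSet)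
    (by
      rw [integral_weightMeasure hopen hne hφint hpos,
        hswap (G := fun x => |u x| ^ (p - 2) * u x) fun x hx => by simp only [hvu hx]]
      simp only [← mul_assoc, hu0, mul_zero])
    (IntegrableOn.integrable_weightMeasure hopen hne hφint hpos <|
      huE.congr_fun (fun x hx => by simp only [hvd x hx]) hopen.measurableSet)
    (by
      rw [integral_weightMeasure hopen hne hφint hpos, integral_weightMeasure hopen hne hφint hpos,
        hvp, hvE, hmin, mul_left_comm])
    (by
      rw [integral_weightMeasure hopen hne hφint hpos, hvp]
      positivity)
  rw [ae_weightMeasure_iff hopen hne hφint hpos, integral_weightMeasure hopen hne hφint hpos,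
    hvp] at key
  filter_upwards [key, ae_restrict_mem hopen.measurableSet] with x hx hxΩ
  rw [hvu hxΩ] at hx
  have hμ0 := muP_nonneg hopen hpos p
  have hμ : (muP p Ω φ ^ (1 / p)) ^ (N + m) = muP p Ω φ ^ (((N : ℝ) + m) / p) := by
    rw [← Real.rpow_natCast, ← Real.rpow_mul hμ0]
    push_cast
    ring_nf
  have hΦp : ((∫ y in Ω, φ y)⁻¹ * ∫ y in Ω, φ y * |u y| ^ p) ^ (1 / p) =
      (∫ y in Ω, φ y) ^ (-(1 : ℝ) / p) * (∫ y in Ω, φ y * |u y| ^ p) ^ ((1 : ℝ) / p) := by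
    rw [Real.mul_rpow (by positivity) hIpos.le, Real.inv_rpow hΦ.le, ← Real.rpow_neg hΦ.le, neg_div]
  rw [hΦp, mul_pow _ (Metric.diam Ω * _), mul_pow (Metric.diam Ω), hμ] at hx
  refine hx.trans ?_
  calc _ = (2 * (((N + m : ℕ) : ℝ) + 1)) ^ (N + m + 1) * (4 * 2 ^ (N + m + 1)) ^ (N + m) *
        (muP p Ω φ ^ (((N : ℝ) + m) / p) * Metric.diam Ω ^ (N + m) *
          ((∫ y in Ω, φ y) ^ (-(1 : ℝ) / p) * (∫ y in Ω, φ y * |u y| ^ p) ^ ((1 : ℝ) / p))) := by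
        ring
    _ ≤ Kinf (N + m) * (muP p Ω φ ^ (((N : ℝ) + m) / p) * Metric.diam Ω ^ (N + m) *
          ((∫ y in Ω, φ y) ^ (-(1 : ℝ) / p) * (∫ y in Ω, φ y * |u y| ^ p) ^ ((1 : ℝ) / p))) := by
        gcongr
        exact explicit_constant_le_Kinf (by omega)
    _ = _ := by ring
end

section
/- Let N ≥ 2, let B₁ and B_N be concentric balls in ℝ^N of radii 1 and N, and let Ω be an open convex set with B₁ ⊂ Ω ⊂ B_N. Then for every Lipschitz function u on the closure of Ω one has ∫_{∂Ω} |u| dH^{N−1} ≤ 4N^{N+1}·(∫_Ω |u| dx + ∫_Ω |∇u| dx); equivalently, the trace constant inf{(∫_Ω |u| + ∫_Ω |∇u|)/∫_{∂Ω}|u|} over u ∈ W^{1,1}(Ω)\W^{1,1}₀(Ω) is at least 1/(4N^{N+1}). -/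
open MeasureTheory Set Filter Topology

/-- The coordinates of `x` other than the `i`-th one. -/
def removeCoord {n : ℕ} (i : Fin (n + 1)) (x : EuclideanSpace ℝ (Fin (n + 1))) : Fin n → ℝ :=
  fun j => x (i.succAbove j)

/-- The boundary points of `Ω` over which `Ω` lies below the cone of slope `n` in the direction
`ε • eᵢ`. -/
def coneFrontier {n : ℕ} (Ω : Set (EuclideanSpace ℝ (Fin (n + 1)))) (i : Fin (n + 1)) (ε : ℝ) :
    Set (EuclideanSpace ℝ (Fin (n + 1))) :=
  {x ∈ frontier Ω | ∀ y ∈ closure Ω,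
    ε * (y i - x i) ≤ n * ‖removeCoord i y - removeCoord i x‖}

/-- The radial projection onto the boundary of a set that is star-shaped around the origin. -/
noncomputable def radialProj {E : Type*} [AddCommGroup E] [Module ℝ E] (Ω : Set E) (x : E) : E :=
  (gauge Ω x)⁻¹ • x

section Geometry

variable {n : ℕ} {Ω : Set (EuclideanSpace ℝ (Fin (n + 1)))} {i : Fin (n + 1)} {ε : ℝ}

lemma continuous_removeCoord (i : Fin (n + 1)) : Continuous (removeCoord i) := by
  unfold removeCoord
  fun_prop

lemma isClosed_coneFrontier : IsClosed (coneFrontier Ω i ε) := by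
  have h : coneFrontier Ω i ε = frontier Ω ∩ ⋂ y ∈ closure Ω,
      {x | ε * (y i - x i) ≤ n * ‖removeCoord i y - removeCoord i x‖} := by
    ext x
    simp [coneFrontier]
  rw [h]
  refine isClosed_frontier.inter (isClosed_biInter fun y _ => isClosed_le (by fun_prop) ?_)
  have := continuous_removeCoord i
  fun_prop

lemma sq_dist_eq_removeCoord (i : Fin (n + 1)) (a b : EuclideanSpace ℝ (Fin (n + 1))) :
    dist a b ^ 2 = (a i - b i) ^ 2 + ∑ j, (removeCoord i a j - removeCoord i b j) ^ 2 := by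
  rw [EuclideanSpace.dist_eq, Real.sq_sqrt (by positivity), Fin.sum_univ_succAbove _ i]
  simp [removeCoord, Real.dist_eq, sq_abs]

lemma dist_le_of_mem_coneFrontier (hε : |ε| = 1) {a b : EuclideanSpace ℝ (Fin (n + 1))}
    (ha : a ∈ coneFrontier Ω i ε) (hb : b ∈ coneFrontier Ω i ε) :
    dist a b ≤ (n + 1 : ℝ) * dist (removeCoord i a) (removeCoord i b) := by
  have h1 := ha.2 b (frontier_subset_closure hb.1)
  have h2 := hb.2 a (frontier_subset_closure ha.1)
  rw [← dist_eq_norm, dist_comm] at h1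
  rw [← dist_eq_norm] at h2
  set D := dist (removeCoord i a) (removeCoord i b) with hD
  have hD0 : 0 ≤ D := dist_nonneg
  have h3 : |a i - b i| ≤ n * D := by
    rw [← one_mul |a i - b i|, ← hε, ← abs_mul, abs_le]
    constructor <;> linarith
  have h4 : ∑ j, (removeCoord i a j - removeCoord i b j) ^ 2 ≤ n * D ^ 2 := by
    have : ∀ j ∈ Finset.univ, (removeCoord i a j - removeCoord i b j) ^ 2 ≤ D ^ 2 := by
      intro j _
      rw [← sq_abs, ← Real.dist_eq]
      gcongr
      exact dist_le_pi_dist _ _ j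
    simpa using Finset.sum_le_sum this
  have h5 : (a i - b i) ^ 2 ≤ (n * D) ^ 2 := by
    rw [← sq_abs]
    gcongr
  refine le_of_sq_le_sq ?_ (by positivity)
  rw [sq_dist_eq_removeCoord i]
  have : (0 : ℝ) ≤ n := by positivity
  nlinarith [mul_nonneg this (sq_nonneg D), sq_nonneg D]

lemma exists_mem_coneFrontier (hopen : IsOpen Ω) (hconv : Convex ℝ Ω) (h0 : 0 ∈ Ω)
    {x : EuclideanSpace ℝ (Fin (n + 1))} (hx : x ∈ frontier Ω) :
    ∃ i, x ∈ coneFrontier Ω i 1 ∪ coneFrontier Ω i (-1) := by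
  obtain ⟨f, hf⟩ := geometric_hahn_banach_open_point hconv hopen
    (fun h => (hopen.frontier_eq ▸ hx).2 h)
  have hf' : ∀ y ∈ closure Ω, f y ≤ f x := by
    have : closure Ω ⊆ {y | f y ≤ f x} :=
      closure_minimal (fun y hy => (hf y hy).le) (isClosed_le (by fun_prop) (by fun_prop))
    exact fun y hy => this hy
  set c : Fin (n + 1) → ℝ := fun j => f (EuclideanSpace.single j 1) with hc
  have hfc : ∀ z, f z = ∑ j, z j * c j := by
    intro z
    have := (EuclideanSpace.basisFun (Fin (n + 1)) ℝ).sum_repr z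
    conv_lhs => rw [← this]
    simp [hc, map_sum]
  obtain ⟨i, -, hi⟩ := Finset.exists_max_image Finset.univ (fun j => |c j|) ⟨0, Finset.mem_univ _⟩
  have hci : 0 < |c i| := by
    rcases (abs_nonneg (c i)).eq_or_lt with h | h
    · have hz : ∀ j, c j = 0 := fun j =>
        abs_eq_zero.1 (le_antisymm ((hi j (Finset.mem_univ _)).trans h.symm.le) (abs_nonneg _))
      have := hf 0 h0
      simp [hfc, hz] at this
    · exact h
  have key : ∀ y ∈ closure Ω,
      c i * (y i - x i) ≤ |c i| * (n * ‖removeCoord i y - removeCoord i x‖) := by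
    intro y hy
    have h1 : f (y - x) ≤ 0 := by
      rw [map_sub]
      linarith [hf' y hy]
    rw [hfc, Fin.sum_univ_succAbove _ i] at h1
    have h2 : ∀ j ∈ Finset.univ,
        -((y - x) (i.succAbove j) * c (i.succAbove j)) ≤
          |c i| * ‖removeCoord i y - removeCoord i x‖ := by
      intro j _
      refine (neg_le_abs _).trans ?_
      rw [abs_mul, mul_comm]
      exact mul_le_mul (hi _ (Finset.mem_univ _))
        (norm_le_pi_norm (removeCoord i y - removeCoord i x) j) (abs_nonneg _) (abs_nonneg _)
    have h3 := Finset.sum_le_sum h2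
    simp only [Finset.sum_neg_distrib, Finset.sum_const, Finset.card_univ, Fintype.card_fin,
      nsmul_eq_mul] at h3
    simp only [PiLp.sub_apply] at h1 h3
    nlinarith
  refine ⟨i, ?_⟩
  rcases le_total 0 (c i) with h | h
  · left
    refine ⟨hx, fun y hy => le_of_mul_le_mul_left ?_ hci⟩
    have := key y hy
    rw [abs_of_nonneg h] at this ⊢
    linarith
  · right
    refine ⟨hx, fun y hy => le_of_mul_le_mul_left ?_ hci⟩
    have := key y hy
    rw [abs_of_nonpos h] at this ⊢
    linarith

lemma single_mem_closure (hin : Metric.ball 0 1 ⊆ Ω) (hε : |ε| = 1) :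
    EuclideanSpace.single i ε ∈ closure Ω := by
  refine closure_mono hin ?_
  rw [closure_ball _ one_ne_zero]
  simp [hε]

/-- Along a line in direction `eᵢ`, the height of the dilated cone boundary grows at least as fast
as the dilation factor. -/
lemma sub_le_of_mem_coneFrontier (hconv : Convex ℝ Ω) (hin : Metric.ball 0 1 ⊆ Ω) (hε : |ε| = 1)
    {a b : EuclideanSpace ℝ (Fin (n + 1))} (ha : a ∈ coneFrontier Ω i ε)
    (hb : b ∈ coneFrontier Ω i ε) {s t : ℝ} (hs : 0 < s) (hst : s ≤ t)
    (hab : t • removeCoord i a = s • removeCoord i b) :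
    t - s ≤ |t * a i - s * b i| := by
  have ht : 0 < t := hs.trans_le hst
  have hw : (s / t) • b + (1 - s / t) • EuclideanSpace.single i ε ∈ closure Ω :=
    hconv.closure (frontier_subset_closure hb.1) (single_mem_closure hin hε) (by positivity)
      (sub_nonneg.2 ((div_le_one ht).2 hst)) (by ring)
  have h1 := ha.2 _ hw
  have h2 : removeCoord i ((s / t) • b + (1 - s / t) • EuclideanSpace.single i ε) =
      removeCoord i a := by
    ext j
    have := congrFun hab j
    simp only [removeCoord, Pi.smul_apply, smul_eq_mul] at this
    simp only [removeCoord, PiLp.add_apply, PiLp.smul_apply, smul_eq_mul, PiLp.single_apply,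
      Fin.succAbove_ne, if_false]
    field_simp
    linarith
  rw [h2, sub_self, norm_zero, mul_zero] at h1
  simp only [PiLp.add_apply, PiLp.smul_apply, smul_eq_mul, PiLp.single_apply, if_true] at h1
  have hεε : ε * ε = 1 := by rw [← abs_mul_abs_self, hε, one_mul]
  have h3 : t * (ε * (s / t * b i + (1 - s / t) * ε - a i)) =
      (t - s) * (ε * ε) - ε * (t * a i - s * b i) := by
    field_simp
    ring
  have h4 := mul_nonpos_of_nonneg_of_nonpos ht.le h1
  rw [h3, hεε] at h4
  have h5 := le_abs_self (ε * (t * a i - s * b i))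
  rw [abs_mul, hε] at h5
  linarith

lemma hausdorffMeasure_le_volume_removeCoord (hε : |ε| = 1)
    {A : Set (EuclideanSpace ℝ (Fin (n + 1)))} (hA : A ⊆ coneFrontier Ω i ε) :
    μH[(n : ℝ)] A ≤ (n + 1 : ENNReal) ^ n * volume (removeCoord i '' A) := by
  have h : AntilipschitzWith (n + 1 : NNReal) (fun x : A => removeCoord i x) := by
    refine AntilipschitzWith.of_le_mul_dist fun a b => ?_
    simpa [Subtype.dist_eq] using dist_le_of_mem_coneFrontier hε (hA a.2) (hA b.2)
  have h1 := h.le_hausdorffMeasure_image (d := n) (by positivity) univ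
  rw [← isometry_subtype_coe.hausdorffMeasure_image (Or.inl (by positivity)), image_univ,
    Subtype.range_coe, image_univ] at h1
  have h2 : range (fun x : A => removeCoord i x) = removeCoord i '' A := by
    rw [image_eq_range]
  have h3 : (μH[(n : ℝ)] : Measure (Fin n → ℝ)) = volume := by
    simpa using hausdorffMeasure_pi_real (ι := Fin n)
  rw [h2, h3] at h1
  simpa using h1


lemma smul_mem_of_mem_frontier (hopen : IsOpen Ω) (hconv : Convex ℝ Ω) (h0 : 0 ∈ Ω)
    {a : EuclideanSpace ℝ (Fin (n + 1))} (ha : a ∈ frontier Ω) {t : ℝ} (ht : t ∈ Ioo (0 : ℝ) 1) :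
    t • a ∈ Ω ∧ radialProj Ω (t • a) = a := by
  have h1 : gauge Ω a = 1 := (gauge_eq_one_iff_mem_frontier hconv (hopen.mem_nhds h0)).2 ha
  have h2 : gauge Ω (t • a) = t := by rw [gauge_smul_of_nonneg ht.1.le, h1, smul_eq_mul, mul_one]
  constructor
  · rw [← hopen.interior_eq, ← gauge_lt_one_iff_mem_interior hconv (hopen.mem_nhds h0), h2]
    exact ht.2
  · rw [radialProj, h2, smul_smul, inv_mul_cancel₀ ht.1.ne', one_smul]

lemma measurable_radialProj (hopen : IsOpen Ω) (hconv : Convex ℝ Ω) (h0 : 0 ∈ Ω) :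
    Measurable (radialProj Ω) := by
  have := (continuous_gauge hconv (hopen.mem_nhds h0)).measurable
  unfold radialProj
  fun_prop

lemma measurableSet_image_removeCoord (hε : |ε| = 1)
    {A : Set (EuclideanSpace ℝ (Fin (n + 1)))} (hAm : MeasurableSet A)
    (hA : A ⊆ coneFrontier Ω i ε) : MeasurableSet (removeCoord i '' A) := by
  refine hAm.image_of_continuousOn_injOn (continuous_removeCoord i).continuousOn ?_
  intro a ha b hb hab
  have := dist_le_of_mem_coneFrontier hε (hA ha) (hA hb)
  rw [hab, dist_self, mul_zero] at this
  exact dist_le_zero.1 this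

end Geometry

lemma volume_le_of_expanding {T S : Set ℝ} (f : ℝ → ℝ) (hf : MapsTo f T S)
    (h : ∀ s ∈ T, ∀ t ∈ T, s ≤ t → t - s ≤ |f t - f s|) : volume T ≤ volume S := by
  have h1 : AntilipschitzWith 1 (fun x : T => f x) := by
    refine AntilipschitzWith.of_le_mul_dist fun a b => ?_
    rw [Subtype.dist_eq, NNReal.coe_one, one_mul, Real.dist_eq, Real.dist_eq]
    rcases le_total (a : ℝ) b with hab | hab
    · rw [abs_sub_comm, abs_of_nonneg (sub_nonneg.2 hab), abs_sub_comm]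
      exact h a a.2 b b.2 hab
    · rw [abs_of_nonneg (sub_nonneg.2 hab)]
      exact h b b.2 a a.2 hab
  have h2 := h1.le_hausdorffMeasure_image (d := 1) zero_le_one univ
  rw [← isometry_subtype_coe.hausdorffMeasure_image (Or.inl zero_le_one), image_univ,
    Subtype.range_coe, hausdorffMeasure_real] at h2
  refine h2.trans ?_
  simp only [ENNReal.coe_one, ENNReal.one_rpow, one_mul]
  refine measure_mono ?_
  rintro _ ⟨x, -, rfl⟩
  exact hf x.2

/-- The mean over `t ∈ (0, 1)` of the volumes of the dilates `t • B`. -/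
lemma volume_eq_mul_lintegral_dilates {n : ℕ} {B : Set (Fin n → ℝ)} (hB : MeasurableSet B) :
    volume B = (n + 1 : ENNReal) * ∫⁻ y : Fin n → ℝ, volume {t : ℝ | t ∈ Ioo 0 1 ∧ t⁻¹ • y ∈ B} := by
  have hS : MeasurableSet {p : ℝ × (Fin n → ℝ) | p.1 ∈ Ioo (0 : ℝ) 1 ∧ p.1⁻¹ • p.2 ∈ B} := by
    refine (measurable_fst measurableSet_Ioo).inter ?_
    have : Measurable fun p : ℝ × (Fin n → ℝ) => p.1⁻¹ • p.2 := by fun_prop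
    exact this hB
  have h1 := Measure.prod_apply_symm (μ := (volume : Measure ℝ))
    (ν := (volume : Measure (Fin n → ℝ))) hS
  rw [Measure.prod_apply hS] at h1
  have h2 : ∀ t : ℝ, volume (Prod.mk t ⁻¹'
      {p : ℝ × (Fin n → ℝ) | p.1 ∈ Ioo (0 : ℝ) 1 ∧ p.1⁻¹ • p.2 ∈ B}) =
      (Ioo (0 : ℝ) 1).indicator (fun t => ENNReal.ofReal (t ^ n) * volume B) t := by
    intro t
    by_cases ht : t ∈ Ioo (0 : ℝ) 1
    · rw [indicator_of_mem ht]
      have := Measure.addHaar_preimage_smul (volume : Measure (Fin n → ℝ)) (inv_ne_zero ht.1.ne') B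
      rw [inv_pow, inv_inv, abs_of_pos (by have := ht.1; positivity),
        Module.finrank_fin_fun] at this
      rw [← this]
      congr 1
      ext y
      simp [ht.1, ht.2]
    · rw [indicator_of_notMem ht]
      refine measure_mono_null (fun y hy => ?_) measure_empty
      exact ht hy.1
  have h3 : ∫⁻ t in Ioo (0 : ℝ) 1, ENNReal.ofReal (t ^ n) = (n + 1 : ENNReal)⁻¹ := by
    rw [← ofReal_integral_eq_lintegral_ofReal]
    · rw [← integral_Ioc_eq_integral_Ioo, ← intervalIntegral.integral_of_le zero_le_one,
        integral_pow]
      simp only [one_pow, ne_eq, Nat.add_eq_zero_iff, one_ne_zero, and_false, not_false_eq_true,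
        zero_pow, sub_zero, one_div]
      rw [ENNReal.ofReal_inv_of_pos (by positivity)]
      congr 1
      rw [ENNReal.ofReal_add (by positivity) zero_le_one]
      simp
    · exact ((continuous_pow n).integrableOn_Icc (a := (0 : ℝ)) (b := 1)).mono_set Ioo_subset_Icc_self
    · filter_upwards [ae_restrict_mem measurableSet_Ioo] with t ht
      exact pow_nonneg ht.1.le n
  simp_rw [h2] at h1
  rw [lintegral_indicator measurableSet_Ioo, lintegral_mul_const _ (by fun_prop), h3] at h1
  have h4 : (n + 1 : ENNReal) * ((n + 1 : ENNReal)⁻¹ * volume B) = volume B := by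
    rw [← mul_assoc, ENNReal.mul_inv_cancel (by simp) (by finiteness), one_mul]
  rw [← h4, h1]
  rfl

lemma MeasureTheory.Measure.restrict_union_le_restrict_union {α : Type*} [MeasurableSpace α]
    {μ ν : Measure α} {s t : Set α} (hs : MeasurableSet s) (h₁ : μ.restrict s ≤ ν.restrict s)
    (h₂ : μ.restrict t ≤ ν.restrict t) : μ.restrict (s ∪ t) ≤ ν.restrict (s ∪ t) := by
  refine Measure.le_iff.2 fun A hA => ?_
  have h₁' := h₁ A
  have h₂' := h₂ (A \ s)
  rw [Measure.restrict_apply hA, Measure.restrict_apply hA] at h₁' ⊢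
  rw [Measure.restrict_apply (hA.diff hs), Measure.restrict_apply (hA.diff hs)] at h₂'
  have e₁ : A ∩ (s ∪ t) ∩ s = A ∩ s := by
    ext x
    simp only [mem_inter_iff, mem_union]
    tauto
  have e₂ : (A ∩ (s ∪ t)) \ s = A \ s ∩ t := by
    ext x
    simp only [mem_inter_iff, mem_union, Set.mem_sdiff]
    tauto
  rw [← measure_inter_add_sdiff (A ∩ (s ∪ t)) hs,
    ← measure_inter_add_sdiff (μ := ν) (A ∩ (s ∪ t)) hs, e₁, e₂]
  exact add_le_add h₁' h₂'

lemma MeasureTheory.Measure.restrict_biUnion_finset_le {α ι : Type*} [MeasurableSpace α]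
    {μ ν : Measure α} {F : ι → Set α} (hF : ∀ p, MeasurableSet (F p))
    (h : ∀ p, μ.restrict (F p) ≤ ν.restrict (F p)) (s : Finset ι) :
    μ.restrict (⋃ p ∈ s, F p) ≤ ν.restrict (⋃ p ∈ s, F p) := by
  classical
  induction s using Finset.induction_on with
  | empty => simp
  | insert a s _ ih =>
    rw [Finset.set_biUnion_insert]
    exact restrict_union_le_restrict_union (hF a) (h a) ih

section Cone

variable {n : ℕ} {Ω : Set (EuclideanSpace ℝ (Fin (n + 1)))} {i : Fin (n + 1)} {ε : ℝ}

lemma volume_image_removeCoord_le (hopen : IsOpen Ω) (hconv : Convex ℝ Ω)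
    (hin : Metric.ball 0 1 ⊆ Ω) (hε : |ε| = 1)
    {A : Set (EuclideanSpace ℝ (Fin (n + 1)))} (hAm : MeasurableSet A)
    (hA : A ⊆ coneFrontier Ω i ε) :
    volume (removeCoord i '' A) ≤ (n + 1 : ENNReal) * volume (Ω ∩ radialProj Ω ⁻¹' A) := by
  have h0 : (0 : EuclideanSpace ℝ (Fin (n + 1))) ∈ Ω := hin (by simp)
  rw [volume_eq_mul_lintegral_dilates (measurableSet_image_removeCoord hε hAm hA)]
  gcongr
  set C := Ω ∩ radialProj Ω ⁻¹' A
  have hC : MeasurableSet C :=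
    hopen.measurableSet.inter (measurable_radialProj hopen hconv h0 hAm)
  set e : EuclideanSpace ℝ (Fin (n + 1)) ≃ᵐ ℝ × (Fin n → ℝ) :=
    (MeasurableEquiv.toLp 2 _).symm.trans (MeasurableEquiv.piFinSuccAbove (fun _ => ℝ) i) with he
  have hmp : MeasurePreserving e volume volume :=
    (EuclideanSpace.volume_preserving_symm_measurableEquiv_toLp _).trans
      (volume_preserving_piFinSuccAbove (fun _ => ℝ) i)
  have hex : ∀ x, e x = (x i, removeCoord i x) := fun x => rfl
  rw [← hmp.symm.measure_preimage_equiv, Measure.volume_eq_prod,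
    Measure.prod_apply_symm (e.symm.measurable hC)]
  refine lintegral_mono fun y => ?_
  choose! a haA ha using fun (t : ℝ) (ht : t⁻¹ • y ∈ removeCoord i '' A) => ht
  have hay : ∀ t ∈ {t : ℝ | t ∈ Ioo 0 1 ∧ t⁻¹ • y ∈ removeCoord i '' A},
      t • removeCoord i (a t) = y := fun t ht => by
    rw [ha t ht.2, smul_smul, mul_inv_cancel₀ ht.1.1.ne', one_smul]
  refine volume_le_of_expanding (fun t => t * a t i) ?_ ?_
  · intro t ht
    have h1 := smul_mem_of_mem_frontier hopen hconv h0 (hA (haA t ht.2)).1 ht.1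
    have h2 : e.symm (t * a t i, y) = t • a t := by
      rw [MeasurableEquiv.symm_apply_eq, hex]
      ext1
      · simp
      · exact (hay t ht).symm
    change e.symm (t * a t i, y) ∈ C
    rw [h2]
    exact ⟨h1.1, by rw [mem_preimage, h1.2]; exact haA t ht.2⟩
  · intro s hs t ht hst
    exact sub_le_of_mem_coneFrontier hconv hin hε (hA (haA t ht.2)) (hA (haA s hs.2)) hs.1.1 hst
      (by rw [hay t ht, hay s hs])

lemma hausdorffMeasure_le_of_subset_coneFrontier (hopen : IsOpen Ω) (hconv : Convex ℝ Ω)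
    (hin : Metric.ball 0 1 ⊆ Ω) (hε : |ε| = 1)
    {A : Set (EuclideanSpace ℝ (Fin (n + 1)))} (hAm : MeasurableSet A)
    (hA : A ⊆ coneFrontier Ω i ε) :
    μH[(n : ℝ)] A ≤ (n + 1 : ENNReal) ^ (n + 1) * volume (Ω ∩ radialProj Ω ⁻¹' A) := by
  refine (hausdorffMeasure_le_volume_removeCoord hε hA).trans ?_
  rw [pow_succ, mul_assoc]
  gcongr
  exact volume_image_removeCoord_le hopen hconv hin hε hAm hA

/-- The surface measure is controlled by the push-forward of the volume under the radial
projection. -/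
theorem hausdorffMeasure_restrict_frontier_le (hopen : IsOpen Ω) (hconv : Convex ℝ Ω)
    (hin : Metric.ball 0 1 ⊆ Ω) :
    (μH[(n : ℝ)]).restrict (frontier Ω) ≤
      (n + 1 : ENNReal) ^ (n + 1) • (volume.restrict Ω).map (radialProj Ω) := by
  have h0 : (0 : EuclideanSpace ℝ (Fin (n + 1))) ∈ Ω := hin (by simp)
  have hmeas := measurable_radialProj hopen hconv h0
  set ν := (n + 1 : ENNReal) ^ (n + 1) • (volume.restrict Ω).map (radialProj Ω) with hν
  have hνA : ∀ A, MeasurableSet A →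
      ν A = (n + 1 : ENNReal) ^ (n + 1) * volume (Ω ∩ radialProj Ω ⁻¹' A) := by
    intro A hA
    rw [hν, Measure.smul_apply, smul_eq_mul, Measure.map_apply hmeas hA,
      Measure.restrict_apply (hmeas hA), inter_comm]
  set F : Fin (n + 1) × Bool → Set (EuclideanSpace ℝ (Fin (n + 1))) := fun p =>
    coneFrontier Ω p.1 (if p.2 then 1 else -1) with hF
  have hle : ∀ p, (μH[(n : ℝ)]).restrict (F p) ≤ ν.restrict (F p) := by
    intro p
    refine Measure.le_iff.2 fun A hA => ?_
    have hFp : MeasurableSet (F p) := isClosed_coneFrontier.measurableSet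
    rw [Measure.restrict_apply hA, Measure.restrict_apply hA, hνA _ (hA.inter hFp)]
    refine hausdorffMeasure_le_of_subset_coneFrontier hopen hconv hin (i := p.1) ?_ (hA.inter hFp)
      inter_subset_right
    split_ifs <;> simp
  have hcover : frontier Ω ⊆ ⋃ p, F p := by
    intro x hx
    obtain ⟨i, hi | hi⟩ := exists_mem_coneFrontier hopen hconv h0 hx
    · exact mem_iUnion.2 ⟨(i, true), by simpa [hF] using hi⟩
    · exact mem_iUnion.2 ⟨(i, false), by simpa [hF] using hi⟩
  calc (μH[(n : ℝ)]).restrict (frontier Ω)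
      ≤ (μH[(n : ℝ)]).restrict (⋃ p, F p) := Measure.restrict_mono hcover le_rfl
    _ ≤ ν.restrict (⋃ p, F p) := by
      simpa using Measure.restrict_biUnion_finset_le
        (fun p => isClosed_coneFrontier.measurableSet) hle Finset.univ
    _ ≤ ν := Measure.restrict_le_self

end Cone

/-- Fundamental theorem of calculus along a ray, for a Lipschitz function. -/
lemma enorm_comp_smul_le {E : Type*} [NormedAddCommGroup E] [NormedSpace ℝ E] {u : E → ℝ}
    {K : NNReal} (hu : LipschitzWith K u) {Ω : Set E} {x : E} {b : ℝ} (hb : 1 ≤ b)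
    (hmem : ∀ s ∈ Ioo 1 b, s • x ∈ Ω)
    (hx : ∀ᵐ s ∂(volume.restrict (Ioi (1 : ℝ))), DifferentiableAt ℝ u (s • x)) :
    ‖u (b • x)‖ₑ ≤ ‖u x‖ₑ + ∫⁻ s in Ioi (1 : ℝ),
      ENNReal.ofReal s⁻¹ * Ω.indicator (fun z => ‖fderiv ℝ u z‖ₑ * ‖z‖ₑ) (s • x) := by
  set f : ℝ → ℝ := fun s => u (s • x) with hf
  have hfL : LipschitzWith (K * ‖x‖₊) f := by
    refine hu.comp (LipschitzWith.of_dist_le_mul fun s t => ?_)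
    rw [dist_eq_norm, ← sub_smul, norm_smul, mul_comm, Real.dist_eq]
    rfl
  have hFTC := (hfL.lipschitzOnWith (s := uIcc 1 b)).absolutelyContinuousOnInterval
    |>.integral_deriv_eq_sub
  have h1 : ‖∫ s in (1 : ℝ)..b, deriv f s‖ₑ ≤ ∫⁻ s in Ioo 1 b, ‖deriv f s‖ₑ := by
    rw [intervalIntegral.integral_of_le hb, integral_Ioc_eq_integral_Ioo]
    exact enorm_integral_le_lintegral_enorm _
  have h2 : ∀ᵐ s ∂(volume.restrict (Ioo 1 b)), ‖deriv f s‖ₑ ≤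
      ENNReal.ofReal s⁻¹ * Ω.indicator (fun z => ‖fderiv ℝ u z‖ₑ * ‖z‖ₑ) (s • x) := by
    filter_upwards [ae_restrict_of_ae_restrict_of_subset Ioo_subset_Ioi_self hx,
      ae_restrict_mem measurableSet_Ioo] with s hs hsb
    have hs0 : (0 : ℝ) < s := zero_lt_one.trans hsb.1
    have hd : HasDerivAt f (fderiv ℝ u (s • x) x) s := by
      have h := hs.hasFDerivAt.comp_hasDerivAt s ((hasDerivAt_id s).smul_const x)
      rw [one_smul] at h
      exact h
    rw [hd.deriv, indicator_of_mem (hmem s hsb), enorm_smul]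
    have e : ENNReal.ofReal s⁻¹ * ‖s‖ₑ = 1 := by
      rw [Real.enorm_eq_ofReal hs0.le, ← ENNReal.ofReal_mul (by positivity),
        inv_mul_cancel₀ hs0.ne', ENNReal.ofReal_one]
    calc ‖fderiv ℝ u (s • x) x‖ₑ ≤ ‖fderiv ℝ u (s • x)‖ₑ * ‖x‖ₑ :=
          ContinuousLinearMap.le_opENorm _ _
      _ = (ENNReal.ofReal s⁻¹ * ‖s‖ₑ) * (‖fderiv ℝ u (s • x)‖ₑ * ‖x‖ₑ) := by rw [e, one_mul]
      _ = _ := by ring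
  have h3 : u (b • x) = u x + ∫ s in (1 : ℝ)..b, deriv f s := by
    rw [hFTC]
    simp [hf]
  rw [h3]
  refine (enorm_add_le _ _).trans ?_
  gcongr
  exact h1.trans ((lintegral_mono_ae h2).trans (lintegral_mono_set Ioo_subset_Ioi_self))

section Radial

open Module

variable {E : Type*} [NormedAddCommGroup E] [NormedSpace ℝ E] [FiniteDimensional ℝ E]
  [MeasurableSpace E] [BorelSpace E] (μ : Measure E) [μ.IsAddHaarMeasure]

lemma lintegral_comp_smul_of_pos {G : E → ENNReal} (hG : Measurable G) {s : ℝ} (hs : 0 < s) :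
    ∫⁻ x, G (s • x) ∂μ = ENNReal.ofReal ((s ^ finrank ℝ E)⁻¹) * ∫⁻ x, G x ∂μ := by
  rw [← lintegral_map hG (by fun_prop : Measurable fun x : E => s • x),
    Measure.map_addHaar_smul μ hs.ne', lintegral_smul_measure, abs_of_pos (by positivity),
    smul_eq_mul]

lemma lintegral_Ioi_one_inv_pow {d : ℕ} (hd : 0 < d) :
    ∫⁻ s in Ioi (1 : ℝ), ENNReal.ofReal (s⁻¹ * (s ^ d)⁻¹) = ENNReal.ofReal ((d : ℝ)⁻¹) := by
  have hd' : (-(d + 1 : ℝ)) < -1 := by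
    have : (0 : ℝ) < d := by exact_mod_cast hd
    linarith
  have h1 : ∀ s ∈ Ioi (1 : ℝ), s⁻¹ * (s ^ d)⁻¹ = s ^ (-(d + 1 : ℝ)) := by
    intro s hs
    have hs0 : (0 : ℝ) < s := zero_lt_one.trans hs
    rw [Real.rpow_neg hs0.le, ← mul_inv, ← pow_succ', ← Real.rpow_natCast]
    push_cast
    rfl
  rw [setLIntegral_congr_fun measurableSet_Ioi (fun s hs => by rw [h1 s hs]),
    ← ofReal_integral_eq_lintegral_ofReal (integrableOn_Ioi_rpow_of_lt hd' zero_lt_one),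
    integral_Ioi_rpow_of_lt hd' zero_lt_one]
  · congr 1
    rw [Real.one_rpow, neg_add, neg_add_cancel_right, neg_div_neg_eq, one_div]
  · filter_upwards [ae_restrict_mem measurableSet_Ioi] with s hs
    exact Real.rpow_nonneg (zero_le_one.trans (le_of_lt hs)) _

lemma lintegral_lintegral_dilates [Nontrivial E] {G : E → ENNReal} (hG : Measurable G) :
    ∫⁻ x, (∫⁻ s in Ioi (1 : ℝ), ENNReal.ofReal s⁻¹ * G (s • x)) ∂μ =
      ENNReal.ofReal ((finrank ℝ E : ℝ)⁻¹) * ∫⁻ x, G x ∂μ := by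
  rw [lintegral_lintegral_swap (by fun_prop)]
  rw [← lintegral_Ioi_one_inv_pow finrank_pos, ← lintegral_mul_const _ (by fun_prop)]
  refine setLIntegral_congr_fun measurableSet_Ioi fun s hs => ?_
  have hs0 : (0 : ℝ) < s := zero_lt_one.trans hs
  change ∫⁻ x, ENNReal.ofReal s⁻¹ * G (s • x) ∂μ = _
  rw [lintegral_const_mul _ (by fun_prop), lintegral_comp_smul_of_pos μ hG hs0, ← mul_assoc,
    ← ENNReal.ofReal_mul (by positivity)]

variable {u : E → ℝ} {K : NNReal}

lemma ae_ae_differentiableAt_smul (hu : LipschitzWith K u) :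
    ∀ᵐ x ∂μ, ∀ᵐ s ∂(volume.restrict (Ioi (1 : ℝ))), DifferentiableAt ℝ u (s • x) := by
  have hD : MeasurableSet {z | DifferentiableAt ℝ u z} := measurableSet_of_differentiableAt ℝ u
  have hm : MeasurableSet {p : E × ℝ | DifferentiableAt ℝ u (p.2 • p.1)} := by
    have : Measurable fun p : E × ℝ => p.2 • p.1 := by fun_prop
    exact this hD
  rw [Measure.ae_ae_comm hm]
  filter_upwards [ae_restrict_mem measurableSet_Ioi] with s hs
  have hs0 : s ≠ 0 := (zero_lt_one.trans hs).ne'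
  have h1 : μ {z | DifferentiableAt ℝ u z}ᶜ = 0 := hu.ae_differentiableAt
  have h2 := Measure.addHaar_preimage_smul μ hs0 {z | DifferentiableAt ℝ u z}ᶜ
  rw [h1, mul_zero] at h2
  exact h2

/-- The mean of the boundary values along rays is controlled by the `W^{1,1}` norm. -/
theorem lintegral_radialProj_le [Nontrivial E] {Ω : Set E} (hopen : IsOpen Ω) (hconv : Convex ℝ Ω)
    (h0 : 0 ∈ Ω) (hout : Ω ⊆ Metric.closedBall 0 (finrank ℝ E)) (hu : LipschitzWith K u) :
    ∫⁻ x in Ω, ‖u (radialProj Ω x)‖ₑ ∂μ ≤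
      (∫⁻ x in Ω, ‖u x‖ₑ ∂μ) + ∫⁻ x in Ω, ‖fderiv ℝ u x‖ₑ ∂μ := by
  have hnhds := hopen.mem_nhds h0
  have hbdd : Bornology.IsVonNBounded ℝ Ω :=
    NormedSpace.isVonNBounded_of_isBounded ℝ (Metric.isBounded_closedBall.subset hout)
  set G : E → ENNReal := Ω.indicator (fun z => ‖fderiv ℝ u z‖ₑ * ‖z‖ₑ) with hGdef
  have hG : Measurable G :=
    Measurable.indicator (by have := measurable_fderiv ℝ u; fun_prop) hopen.measurableSet
  have hpt : ∀ᵐ x ∂(μ.restrict Ω), ‖u (radialProj Ω x)‖ₑ ≤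
      ‖u x‖ₑ + ∫⁻ s in Ioi (1 : ℝ), ENNReal.ofReal s⁻¹ * G (s • x) := by
    filter_upwards [ae_restrict_mem hopen.measurableSet,
      ae_restrict_of_ae (ae_ae_differentiableAt_smul μ hu),
      ae_restrict_of_ae (Measure.ae_ne μ (0 : E))] with x hxΩ hx hx0
    have hg0 : 0 < gauge Ω x := (gauge_pos (absorbent_nhds_zero hnhds) hbdd).2 hx0
    have hg1 : gauge Ω x < 1 := by
      rwa [gauge_lt_one_iff_mem_interior hconv hnhds, hopen.interior_eq]
    refine enorm_comp_smul_le hu ((one_le_inv₀ hg0).2 hg1.le) (fun s hs => ?_) hx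
    have hs0 : (0 : ℝ) < s := zero_lt_one.trans hs.1
    rw [← hopen.interior_eq, ← gauge_lt_one_iff_mem_interior hconv hnhds,
      gauge_smul_of_nonneg hs0.le, smul_eq_mul, ← lt_inv_mul_iff₀' hg0, mul_one]
    exact hs.2
  refine (lintegral_mono_ae hpt).trans ?_
  rw [lintegral_add_left (by have := hu.continuous.measurable; fun_prop)]
  refine add_le_add le_rfl ?_
  refine (setLIntegral_le_lintegral _ _).trans ?_
  rw [lintegral_lintegral_dilates μ hG, hGdef, lintegral_indicator hopen.measurableSet,
    ← lintegral_const_mul _ (by have := measurable_fderiv ℝ u; fun_prop)]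
  refine setLIntegral_mono' hopen.measurableSet fun z hz => ?_
  have hd : (0 : ℝ) < finrank ℝ E := by exact_mod_cast finrank_pos
  have hz' : ENNReal.ofReal (finrank ℝ E : ℝ)⁻¹ * ‖z‖ₑ ≤ 1 := by
    rw [← ofReal_norm, ← ENNReal.ofReal_mul (by positivity), ENNReal.ofReal_le_one,
      inv_mul_le_one₀ hd]
    simpa using hout hz
  calc _ = (ENNReal.ofReal (finrank ℝ E : ℝ)⁻¹ * ‖z‖ₑ) * ‖fderiv ℝ u z‖ₑ := by ring
    _ ≤ 1 * ‖fderiv ℝ u z‖ₑ := by gcongr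
    _ = _ := one_mul _

end Radial

/-- The trace inequality for a convex set around the origin, with the constant `N ^ N`. -/
theorem lintegral_frontier_enorm_le {n : ℕ} {Ω : Set (EuclideanSpace ℝ (Fin (n + 1)))}
    (hopen : IsOpen Ω) (hconv : Convex ℝ Ω) (hin : Metric.ball 0 1 ⊆ Ω)
    (hout : Ω ⊆ Metric.closedBall 0 (n + 1)) {u : EuclideanSpace ℝ (Fin (n + 1)) → ℝ} {K : NNReal}
    (hu : LipschitzWith K u) :
    ∫⁻ x in frontier Ω, ‖u x‖ₑ ∂μH[(n : ℝ)] ≤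
      (n + 1 : ENNReal) ^ (n + 1) * ((∫⁻ x in Ω, ‖u x‖ₑ) + ∫⁻ x in Ω, ‖fderiv ℝ u x‖ₑ) := by
  have h0 : (0 : EuclideanSpace ℝ (Fin (n + 1))) ∈ Ω := hin (by simp)
  have hum : Measurable u := hu.continuous.measurable
  refine (lintegral_mono' (hausdorffMeasure_restrict_frontier_le hopen hconv hin) le_rfl).trans ?_
  rw [lintegral_smul_measure, smul_eq_mul,
    lintegral_map (by fun_prop) (measurable_radialProj hopen hconv h0)]
  exact mul_le_mul_right
    (lintegral_radialProj_le volume hopen hconv h0 (by simpa using hout) hu) _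

theorem lintegral_frontier_enorm_le_of_center {n : ℕ} (x₀ : EuclideanSpace ℝ (Fin (n + 1)))
    {Ω : Set (EuclideanSpace ℝ (Fin (n + 1)))} (hopen : IsOpen Ω) (hconv : Convex ℝ Ω)
    (hin : Metric.ball x₀ 1 ⊆ Ω) (hout : Ω ⊆ Metric.closedBall x₀ (n + 1))
    {u : EuclideanSpace ℝ (Fin (n + 1)) → ℝ} {K : NNReal} (hu : LipschitzWith K u) :
    ∫⁻ x in frontier Ω, ‖u x‖ₑ ∂μH[(n : ℝ)] ≤
      (n + 1 : ENNReal) ^ (n + 1) * ((∫⁻ x in Ω, ‖u x‖ₑ) + ∫⁻ x in Ω, ‖fderiv ℝ u x‖ₑ) := by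
  set τ := IsometryEquiv.addRight x₀ with hτ
  have hτx : ∀ x, τ x = x + x₀ := fun x => rfl
  have hemb : MeasurableEmbedding τ := τ.toHomeomorph.measurableEmbedding
  have hvol : MeasurePreserving τ volume volume := measurePreserving_add_right volume x₀
  have hH := τ.measurePreserving_hausdorffMeasure (n : ℝ)
  have hin' : Metric.ball 0 1 ⊆ τ ⁻¹' Ω := fun x hx => hin (by simpa [hτx] using hx)
  have hout' : τ ⁻¹' Ω ⊆ Metric.closedBall 0 (n + 1) := fun x hx => by
    simpa [hτx] using hout hx
  have hconv' : Convex ℝ (τ ⁻¹' Ω) := hconv.translate_preimage_left x₀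
  have hfr : frontier (τ ⁻¹' Ω) = τ ⁻¹' frontier Ω :=
    (τ.toHomeomorph.preimage_frontier Ω).symm
  have key := lintegral_frontier_enorm_le (hopen.preimage τ.continuous) hconv' hin' hout'
    (hu.comp τ.isometry.lipschitz)
  have hfd : ∀ x, fderiv ℝ (u ∘ τ) x = fderiv ℝ u (τ x) := fun x =>
    fderiv_comp_add_right x₀
  simp_rw [hfd, Function.comp_apply] at key
  rwa [hfr, hH.setLIntegral_comp_preimage_emb hemb (fun x => ‖u x‖ₑ),
    hvol.setLIntegral_comp_preimage_emb hemb (fun x => ‖u x‖ₑ),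
    hvol.setLIntegral_comp_preimage_emb hemb (fun x => ‖fderiv ℝ u x‖ₑ)] at key

/-- Lemma 3.5, trace estimate in `W^{1,1}`: if `B(x₀,1) ⊆ Ω ⊆ B(x₀,N)` with
`Ω` open and convex, then every Lipschitz function `u` on the closure of `Ω` satisfies
`∫_{∂Ω} |u| dH^{N-1} ≤ 4 N^{N+1} (∫_Ω |u| + ∫_Ω |∇u|)`; equivalently the `W^{1,1}` trace
constant of `Ω` is at least `1/(4N^{N+1})`. -/
theorem stmt8 (N : ℕ) (hN : 2 ≤ N) (x₀ : EuclideanSpace ℝ (Fin N))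
    (Ω : Set (EuclideanSpace ℝ (Fin N)))
    (hopen : IsOpen Ω) (hconv : Convex ℝ Ω)
    (hin : Metric.ball x₀ 1 ⊆ Ω) (hout : Ω ⊆ Metric.closedBall x₀ N)
    (u : EuclideanSpace ℝ (Fin N) → ℝ) (K : NNReal)
    (hu : LipschitzOnWith K u (closure Ω)) :
    (∫ x in frontier Ω, |u x| ∂(μH[(N : ℝ) - 1])) ≤
      4 * (N : ℝ) ^ (N + 1) * ((∫ x in Ω, |u x|) + ∫ x in Ω, ‖fderiv ℝ u x‖) := by
  obtain ⟨n, rfl⟩ : ∃ n, N = n + 1 := ⟨N - 1, by omega⟩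
  obtain ⟨w, hw, hwu⟩ := hu.extend_real
  have hΩ : MeasurableSet Ω := hopen.measurableSet
  have hfd : ∀ x ∈ Ω, fderiv ℝ u x = fderiv ℝ w x := fun x hx =>
    (hwu.mono subset_closure).eventuallyEq_of_mem (hopen.mem_nhds hx) |>.fderiv_eq
  have e₁ : ∫ x in frontier Ω, |u x| ∂(μH[((n + 1 : ℕ) : ℝ) - 1]) =
      ∫ x in frontier Ω, ‖w x‖ ∂(μH[(n : ℝ)]) := by
    rw [show ((n + 1 : ℕ) : ℝ) - 1 = n by push_cast; ring]
    refine setIntegral_congr_fun isClosed_frontier.measurableSet fun x hx => ?_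
    simp only [hwu (frontier_subset_closure hx), Real.norm_eq_abs]
  have e₂ : ∫ x in Ω, |u x| = ∫ x in Ω, ‖w x‖ :=
    setIntegral_congr_fun hΩ fun x hx => by
      simp only [hwu (subset_closure hx), Real.norm_eq_abs]
  have e₃ : ∫ x in Ω, ‖fderiv ℝ u x‖ = ∫ x in Ω, ‖fderiv ℝ w x‖ :=
    setIntegral_congr_fun hΩ fun x hx => by simp only [hfd x hx]
  have hbdd : Bornology.IsBounded Ω := Metric.isBounded_closedBall.subset hout
  have hfin : volume Ω ≠ ⊤ := hbdd.measure_lt_top.ne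
  have hi₁ : IntegrableOn w Ω := by
    refine (hw.continuous.continuousOn.integrableOn_compact ?_).mono_set subset_closure
    exact hbdd.isCompact_closure
  have hi₂ : IntegrableOn (fderiv ℝ w) Ω :=
    Measure.integrableOn_of_bounded hfin (measurable_fderiv ℝ w).aestronglyMeasurable
      (M := K) (ae_of_all _ fun x => norm_fderiv_le_of_lipschitz ℝ hw)
  have key := lintegral_frontier_enorm_le_of_center x₀ hopen hconv hin (by simpa using hout) hw
  have hf₁ : ∫⁻ x in Ω, ‖w x‖ₑ ≠ ⊤ := hi₁.2.ne
  have hf₂ : ∫⁻ x in Ω, ‖fderiv ℝ w x‖ₑ ≠ ⊤ := hi₂.2.ne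
  have key' := ENNReal.toReal_mono (by finiteness) key
  rw [ENNReal.toReal_mul, ENNReal.toReal_add hf₁ hf₂,
    ← integral_norm_eq_lintegral_enorm hw.continuous.aestronglyMeasurable,
    ← integral_norm_eq_lintegral_enorm hi₁.1, ← integral_norm_eq_lintegral_enorm hi₂.1] at key'
  rw [e₁, e₂, e₃]
  refine key'.trans ?_
  have hnn : 0 ≤ (∫ x in Ω, ‖w x‖) + ∫ x in Ω, ‖fderiv ℝ w x‖ := by positivity
  refine mul_le_mul_of_nonneg_right ?_ hnn
  have hc : ((n + 1 : ENNReal) ^ (n + 1)).toReal = (n + 1 : ℝ) ^ (n + 1) := by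
    rw [ENNReal.toReal_pow, ENNReal.toReal_add (by finiteness) (by finiteness)]
    simp
  rw [hc]
  push_cast
  have h1 : (1 : ℝ) ≤ n + 1 := by simp
  have h2 : (n + 1 : ℝ) ^ (n + 1) ≤ (n + 1 : ℝ) ^ (n + 1 + 1) :=
    pow_le_pow_right₀ h1 (Nat.le_succ _)
  have h3 : (0 : ℝ) ≤ (n + 1 : ℝ) ^ (n + 1 + 1) := by positivity
  linarith
end
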